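/- arXiv:2302.01175 — 4 statements merged into one kernel-verified Lean document; each statement's English description precedes it below -/
import Mathlib

section
/- Consider the regularized Lur'e system ẋ ∈ F(x) with F(x) := {Ax + Bu : u ∈ −ΨΨ(Cx)}. If Assumption 1 (sector condition) and Assumption 2 (strict passivity LMI) hold, then the origin is globally asymptotically stable: there exists a class-KL function β such that every Krasovskii solution x : [0,T) → ℝⁿ satisfies |x(t)| ≤ β(|x(0)|, t) for all t ∈ [0,T). -/
open Matrix MeasureTheory Filter Set
open scoped ENNReal

noncomputable section

/-- Euclidean norm on `Fin m → ℝ`. -/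
def euclNorm {m : ℕ} (x : Fin m → ℝ) : ℝ := Real.sqrt (∑ i, x i ^ 2)

/-- Krasovskii regularization of a scalar function `ψ` at `y`:
`Ψ(y) = ⋂_{δ>0} closure (convexHull (ψ '' [y-δ, y+δ]))`. -/
def kras (ψ : ℝ → ℝ) (y : ℝ) : Set ℝ :=
  ⋂ δ ∈ Set.Ioi (0 : ℝ), closure (convexHull ℝ (ψ '' Set.Icc (y - δ) (y + δ)))

/-- Product (decentralized) Krasovskii regularization `ΨΨ(y) = Ψ₁(y₁) × ⋯ × Ψ_p(y_p)`. -/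
def PsiSet {p : ℕ} (ψ : Fin p → ℝ → ℝ) (y : Fin p → ℝ) : Set (Fin p → ℝ) :=
  {w | ∀ i, w i ∈ kras (ψ i) (y i)}

/-- The regularized Lur'e set-valued dynamics `F(x) = {Ax + Bu : u ∈ -ΨΨ(Cx)}`. -/
def lureF {n p : ℕ} (A : Matrix (Fin n) (Fin n) ℝ) (B : Matrix (Fin n) (Fin p) ℝ)
    (C : Matrix (Fin p) (Fin n) ℝ) (ψ : Fin p → ℝ → ℝ) (x : Fin n → ℝ) :
    Set (Fin n → ℝ) :=
  {f | ∃ u : Fin p → ℝ, (fun i => -u i) ∈ PsiSet ψ (C.mulVec x) ∧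
        f = A.mulVec x + B.mulVec u}

/-- Piecewise continuity: finitely many discontinuity points on every compact
interval, and finite one-sided limits at every point. -/
def PiecewiseContinuous (f : ℝ → ℝ) : Prop :=
  (∀ a b : ℝ, {s ∈ Set.Icc a b | ¬ ContinuousAt f s}.Finite) ∧
  (∀ x : ℝ, (∃ L : ℝ, Tendsto f (nhdsWithin x (Set.Ioi x)) (nhds L)) ∧
    (∃ L : ℝ, Tendsto f (nhdsWithin x (Set.Iio x)) (nhds L)))

/-- Sector condition: there is `ζ = 1/z ∈ (0, +∞]` (with `z = ζ⁻¹ ≥ 0`, `z = 0`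
corresponding to `ζ = +∞`) such that `ψ(s)(ψ(s) - ζ s) ≤ 0` for all `s`. -/
def Sector (ψ : ℝ → ℝ) (z : ℝ) : Prop :=
  (z = 0 ∧ ∀ s : ℝ, 0 ≤ s * ψ s) ∨
  (0 < z ∧ ∀ s : ℝ, ψ s * (ψ s - (1 / z) * s) ≤ 0)

/-- Class `KL` functions. -/
def ClassKL (β : ℝ → ℝ → ℝ) : Prop :=
  (∀ t : ℝ, 0 ≤ t → ContinuousOn (fun s => β s t) (Set.Ici 0) ∧
    StrictMonoOn (fun s => β s t) (Set.Ici 0) ∧ β 0 t = 0) ∧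
  (∀ s : ℝ, 0 ≤ s → AntitoneOn (fun t => β s t) (Set.Ici 0) ∧
    Tendsto (fun t => β s t) atTop (nhds 0))

/-- Class `K∞` functions. -/
def ClassKInf (α : ℝ → ℝ) : Prop :=
  ContinuousOn α (Set.Ici 0) ∧ StrictMonoOn α (Set.Ici 0) ∧ α 0 = 0 ∧
  Tendsto α atTop atTop

/-- A Krasovskii solution of `ẋ ∈ F(x)` on a time set `s` (a locally absolutely
continuous function whose derivative belongs to `F(x(t))` almost everywhere),
formalized through the integral representation `x(t) = x(0) + ∫₀ᵗ f(τ) dτ`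
with `f(τ) ∈ F(x(τ))` for a.e. `τ ∈ s`. -/
def IsKrasovskiiSolutionOn {n : ℕ} (F : (Fin n → ℝ) → Set (Fin n → ℝ))
    (x : ℝ → Fin n → ℝ) (s : Set ℝ) : Prop :=
  ∃ f : ℝ → Fin n → ℝ,
    (∀ t ∈ s, IntervalIntegrable f volume 0 t) ∧
    (∀ᵐ t ∂volume, t ∈ s → f t ∈ F (x t)) ∧
    ∀ t ∈ s, x t = x 0 + ∫ τ in (0:ℝ)..t, f τ

/-- The time interval `[0, T)` with `T ∈ (0, +∞]`. -/
def timeItv (T : ℝ≥0∞) : Set ℝ := {t : ℝ | 0 ≤ t ∧ ENNReal.ofReal t < T}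

/-- Global asymptotic stability of the origin: a class-`KL` bound holds along
every Krasovskii solution on every time interval `[0, T)`. -/
def GASOrigin {n p : ℕ} (A : Matrix (Fin n) (Fin n) ℝ) (B : Matrix (Fin n) (Fin p) ℝ)
    (C : Matrix (Fin p) (Fin n) ℝ) (ψ : Fin p → ℝ → ℝ) : Prop :=
  ∃ β : ℝ → ℝ → ℝ, ClassKL β ∧
    ∀ T : ℝ≥0∞, ∀ x : ℝ → Fin n → ℝ,
      IsKrasovskiiSolutionOn (lureF A B C ψ) x (timeItv T) →
      ∀ t ∈ timeItv T, euclNorm (x t) ≤ β (euclNorm (x 0)) t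

theorem Sector.mul_sq_le {ψ : ℝ → ℝ} {z : ℝ} (h : Sector ψ z) :
    0 ≤ z ∧ ∀ s, z * ψ s ^ 2 ≤ s * ψ s := by
  rcases h with ⟨rfl, h⟩ | ⟨hz, h⟩
  · exact ⟨le_rfl, fun s => by simpa using h s⟩
  · refine ⟨hz.le, fun s => ?_⟩
    have h1 := mul_nonpos_of_nonneg_of_nonpos hz.le (h s)
    have h2 : z * (ψ s * (ψ s - 1 / z * s)) = z * ψ s ^ 2 - s * ψ s := by
      field_simp
    linarith

/-- A linear bound on `ψ` near `y` passes to the Krasovskii regularization at `y`. -/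
theorem mul_le_of_mem_kras {ψ : ℝ → ℝ} {y w δ c b : ℝ} (hw : w ∈ kras ψ y) (hδ : 0 < δ)
    (h : ∀ s ∈ Icc (y - δ) (y + δ), c * ψ s ≤ b) : c * w ≤ b := by
  have hw' : w ∈ closure (convexHull ℝ (ψ '' Icc (y - δ) (y + δ))) := by
    simp only [kras, mem_iInter] at hw
    exact hw δ hδ
  have hclosed : IsClosed {v : ℝ | c * v ≤ b} :=
    isClosed_le (continuous_const.mul continuous_id) continuous_const
  have hconv : Convex ℝ {v : ℝ | c * v ≤ b} :=
    convex_halfSpace_le (IsLinearMap.mk (fun _ _ => by ring)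
      (fun _ _ => by simp only [smul_eq_mul]; ring)) b
  refine closure_minimal (convexHull_min ?_ hconv) hclosed hw'
  rintro _ ⟨s, hs, rfl⟩
  exact h s hs

theorem kras_sector {ψ : ℝ → ℝ} {z y w : ℝ} (hz : 0 ≤ z)
    (h : ∀ s, z * ψ s ^ 2 ≤ s * ψ s) (hw : w ∈ kras ψ y) : z * w ^ 2 ≤ y * w := by
  have hpos : ∀ s, 0 < s → 0 ≤ ψ s ∧ z * ψ s ≤ s := fun s hs => by
    have h0 : 0 ≤ ψ s := by
      by_contra! hc
      nlinarith [h s, mul_nonneg hz (sq_nonneg (ψ s)), mul_neg_of_pos_of_neg hs hc]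
    refine ⟨h0, ?_⟩
    rcases h0.eq_or_lt with h1 | h1
    · rw [← h1]; simpa using hs.le
    · exact le_of_mul_le_mul_right (by nlinarith [h s]) h1
  have hneg : ∀ s, s < 0 → ψ s ≤ 0 ∧ s ≤ z * ψ s := fun s hs => by
    have h0 : ψ s ≤ 0 := by
      by_contra! hc
      nlinarith [h s, mul_nonneg hz (sq_nonneg (ψ s)), mul_neg_of_neg_of_pos hs hc]
    refine ⟨h0, ?_⟩
    rcases h0.eq_or_lt with h1 | h1
    · rw [h1]; simpa using hs.le
    · exact le_of_mul_le_mul_right (a := -ψ s) (by nlinarith [h s]) (by linarith)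
  rcases lt_trichotomy y 0 with hy | rfl | hy
  · have h1 : (1 : ℝ) * w ≤ 0 := mul_le_of_mem_kras hw (δ := -y / 2) (by linarith)
      fun s hs => by simpa using (hneg s (by linarith [hs.2])).1
    have h2 : -z * w ≤ -y := by
      refine le_of_forall_pos_le_add fun ε hε => ?_
      refine mul_le_of_mem_kras hw (δ := min ε (-y / 2)) (lt_min hε (by linarith)) fun s hs => ?_
      have := min_le_left ε (-y / 2)
      have := min_le_right ε (-y / 2)
      have := (hneg s (by linarith [hs.2])).2
      linarith [hs.1]
    nlinarith
  · have h1 : ∀ s ≠ 0, |z * ψ s| ≤ |s| := fun s hs => by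
      rcases hs.lt_or_gt with h' | h'
      · rw [abs_of_neg h', abs_of_nonpos (mul_nonpos_of_nonneg_of_nonpos hz (hneg s h').1)]
        linarith [(hneg s h').2]
      · rw [abs_of_pos h', abs_of_nonneg (mul_nonneg hz (hpos s h').1)]
        exact (hpos s h').2
    have h0 : z * ψ 0 = 0 := by
      have := h 0
      rcases hz.eq_or_lt with h' | h'
      · simp [← h']
      · have : ψ 0 ^ 2 ≤ 0 := by
          by_contra! hc
          nlinarith [mul_pos h' hc]
        simp [pow_eq_zero_iff (two_ne_zero) |>.1 (le_antisymm this (sq_nonneg _))]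
    have h2 : ∀ s, |z * ψ s| ≤ |s| := fun s => by
      by_cases hs : s = 0
      · simp [hs, h0]
      · exact h1 s hs
    have h3 : ∀ ε > 0, ∀ s ∈ Icc ((0 : ℝ) - ε) (0 + ε), |z * ψ s| ≤ ε := fun ε _ s hs =>
      (h2 s).trans (abs_le.2 ⟨by linarith [hs.1], by linarith [hs.2]⟩)
    have h4 : z * w ≤ 0 := le_of_forall_pos_le_add fun ε hε =>
      mul_le_of_mem_kras hw hε fun s hs => by linarith [(abs_le.1 (h3 ε hε s hs)).2]
    have h5 : -z * w ≤ 0 := le_of_forall_pos_le_add fun ε hε =>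
      mul_le_of_mem_kras hw hε fun s hs => by linarith [(abs_le.1 (h3 ε hε s hs)).1]
    have h6 : z * w = 0 := by linarith
    rw [sq, ← mul_assoc, h6]
  · have h1 : (-1 : ℝ) * w ≤ 0 := mul_le_of_mem_kras hw (δ := y / 2) (by linarith)
      fun s hs => by linarith [(hpos s (by linarith [hs.1])).1]
    have h2 : z * w ≤ y := by
      refine le_of_forall_pos_le_add fun ε hε => ?_
      refine mul_le_of_mem_kras hw (δ := min ε (y / 2)) (lt_min hε (by linarith)) fun s hs => ?_
      have := min_le_left ε (y / 2)
      have := min_le_right ε (y / 2)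
      have := (hpos s (by linarith [hs.1])).2
      linarith [hs.2]
    nlinarith

theorem eq_of_mem_kras_of_continuousAt {ψ : ℝ → ℝ} {y w : ℝ} (hw : w ∈ kras ψ y)
    (h : ContinuousAt ψ y) : w = ψ y := by
  have key : ∀ ε > 0, ∃ δ > 0, ∀ s ∈ Icc (y - δ) (y + δ), |ψ s - ψ y| ≤ ε := fun ε hε => by
    obtain ⟨δ, hδ, H⟩ := Metric.continuousAt_iff.1 h ε hε
    refine ⟨δ / 2, by positivity, fun s hs => (H ?_).le⟩
    rw [Real.dist_eq, abs_lt]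
    constructor <;> linarith [hs.1, hs.2]
  apply le_antisymm
  · refine le_of_forall_pos_le_add fun ε hε => ?_
    obtain ⟨δ, hδ, H⟩ := key ε hε
    linarith [mul_le_of_mem_kras (c := 1) (b := ψ y + ε) hw hδ fun s hs => by
      linarith [(abs_le.1 (H s hs)).2]]
  · refine le_of_forall_pos_le_add fun ε hε => ?_
    obtain ⟨δ, hδ, H⟩ := key ε hε
    linarith [mul_le_of_mem_kras (c := -1) (b := -ψ y + ε) hw hδ fun s hs => by
      linarith [(abs_le.1 (H s hs)).1]]

theorem PiecewiseContinuous.exists_bound {ψ : ℝ → ℝ} (h : PiecewiseContinuous ψ) (a b : ℝ) :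
    ∃ M, ∀ s ∈ Icc a b, |ψ s| ≤ M := by
  refine isCompact_Icc.induction_on (p := fun S => ∃ M, ∀ s ∈ S, |ψ s| ≤ M) ⟨0, by simp⟩
    (fun S T hST ⟨M, hM⟩ => ⟨M, fun s hs => hM s (hST hs)⟩)
    (fun S T ⟨M, hM⟩ ⟨N, hN⟩ => ⟨max M N, ?_⟩) fun x _ => ?_
  · rintro s (hs | hs)
    · exact (hM s hs).trans (le_max_left _ _)
    · exact (hN s hs).trans (le_max_right _ _)
  · obtain ⟨⟨L, hL⟩, ⟨K, hK⟩⟩ := h.2 x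
    have hL' := hL.abs.eventually_le_const (lt_add_one |L|)
    have hK' := hK.abs.eventually_le_const (lt_add_one |K|)
    refine ⟨{s | |ψ s| ≤ max |ψ x| (max (|L| + 1) (|K| + 1))}, ?_, _, fun s hs => hs⟩
    refine mem_nhdsWithin_of_mem_nhds ?_
    rw [← nhdsNE_sup_pure, ← nhdsLT_sup_nhdsGT]
    refine ⟨⟨?_, ?_⟩, ?_⟩
    · filter_upwards [hK'] with s hs using by simp [hs]
    · filter_upwards [hL'] with s hs using by simp [hs]
    · simp

theorem PiecewiseContinuous.countable {ψ : ℝ → ℝ} (h : PiecewiseContinuous ψ) :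
    {s | ¬ ContinuousAt ψ s}.Countable := by
  refine (countable_iUnion fun k : ℕ => (h.1 (-k) k).countable).mono fun s hs => ?_
  obtain ⟨k, hk⟩ := exists_nat_ge |s|
  exact mem_iUnion.2 ⟨k, abs_le.1 hk, hs⟩

theorem PiecewiseContinuous.aestronglyMeasurable {ψ : ℝ → ℝ} (h : PiecewiseContinuous ψ) :
    AEStronglyMeasurable ψ volume := by
  have h1 : ContinuousOn ψ {s | ¬ ContinuousAt ψ s}ᶜ := fun s hs =>
    ContinuousAt.continuousWithinAt (by simpa using hs)
  have h2 := h1.aestronglyMeasurable (μ := volume) h.countable.measurableSet.compl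
  rwa [Measure.restrict_eq_self_of_ae_mem] at h2
  exact h.countable.ae_notMem _

theorem PiecewiseContinuous.intervalIntegrable {ψ : ℝ → ℝ} (h : PiecewiseContinuous ψ)
    (a b : ℝ) : IntervalIntegrable ψ volume a b := by
  obtain ⟨M, hM⟩ := h.exists_bound (min a b) (max a b)
  rw [intervalIntegrable_iff]
  refine Measure.integrableOn_of_bounded (M := M) (by simp [uIoc]) h.aestronglyMeasurable ?_
  refine (ae_restrict_iff' measurableSet_uIoc).2 (ae_of_all _ fun s hs => ?_)
  exact hM s (uIoc_subset_uIcc hs)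

/-- The primitive of `ψ` vanishing at the origin. -/
def primitive (ψ : ℝ → ℝ) (y : ℝ) : ℝ := ∫ s in (0 : ℝ)..y, ψ s

theorem primitive_zero (ψ : ℝ → ℝ) : primitive ψ 0 = 0 := by simp [primitive]

theorem primitive_sub {ψ : ℝ → ℝ} (h : PiecewiseContinuous ψ) (a b : ℝ) :
    primitive ψ b - primitive ψ a = ∫ s in a..b, ψ s :=
  intervalIntegral.integral_interval_sub_left (h.intervalIntegrable _ _)
    (h.intervalIntegrable _ _)

theorem primitive_lipschitzOn {ψ : ℝ → ℝ} (h : PiecewiseContinuous ψ) (a b : ℝ) :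
    ∃ K : NNReal, LipschitzOnWith K (primitive ψ) (Icc a b) := by
  obtain ⟨M, hM⟩ := h.exists_bound a b
  refine ⟨M.toNNReal, LipschitzOnWith.of_dist_le_mul fun u hu v hv => ?_⟩
  rw [dist_comm u v, dist_comm (primitive ψ u), Real.dist_eq, Real.dist_eq, primitive_sub h]
  rw [← Real.norm_eq_abs, ← Real.norm_eq_abs]
  refine (intervalIntegral.norm_integral_le_of_norm_le_const fun s hs => ?_)
  have hs' : s ∈ Icc a b := (uIcc_subset_Icc hu hv) (uIoc_subset_uIcc hs)
  exact (hM s hs').trans (Real.le_coe_toNNReal M)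

theorem continuous_primitive {ψ : ℝ → ℝ} (h : PiecewiseContinuous ψ) :
    Continuous (primitive ψ) :=
  intervalIntegral.continuous_primitive (fun a b => h.intervalIntegrable a b) 0

theorem hasDerivAt_primitive {ψ : ℝ → ℝ} (h : PiecewiseContinuous ψ) {y : ℝ}
    (hy : ContinuousAt ψ y) : HasDerivAt (primitive ψ) (ψ y) y :=
  intervalIntegral.integral_hasDerivAt_right (h.intervalIntegrable _ _)
    h.aestronglyMeasurable.stronglyMeasurableAtFilter hy

theorem monotoneOn_primitive {ψ : ℝ → ℝ} (h : PiecewiseContinuous ψ)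
    (hs : ∀ s, 0 ≤ s * ψ s) : MonotoneOn (primitive ψ) (Ici 0) := by
  intro a ha b _ hab
  have : 0 ≤ ∫ s in a..b, ψ s := by
    refine intervalIntegral.integral_nonneg_of_ae_restrict hab ?_
    rw [EventuallyLE, ae_restrict_iff' measurableSet_Icc]
    filter_upwards [Measure.ae_ne volume (0 : ℝ)] with s hs0 hsI
    have hpos : 0 < s := lt_of_le_of_ne (le_trans ha hsI.1) (Ne.symm hs0)
    exact nonneg_of_mul_nonneg_right (hs s) hpos
  linarith [primitive_sub h a b]

theorem antitoneOn_primitive {ψ : ℝ → ℝ} (h : PiecewiseContinuous ψ)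
    (hs : ∀ s, 0 ≤ s * ψ s) : AntitoneOn (primitive ψ) (Iic 0) := by
  intro a _ b hb hab
  have : 0 ≤ ∫ s in a..b, -ψ s := by
    refine intervalIntegral.integral_nonneg_of_ae_restrict hab ?_
    rw [EventuallyLE, ae_restrict_iff' measurableSet_Icc]
    filter_upwards [Measure.ae_ne volume (0 : ℝ)] with s hs0 hsI
    have hneg : s < 0 := lt_of_le_of_ne (hsI.2.trans hb) hs0
    have := hs s
    simp only [Pi.zero_apply]
    by_contra! hc
    nlinarith
  rw [intervalIntegral.integral_neg] at this
  linarith [primitive_sub h a b]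

theorem primitive_nonneg {ψ : ℝ → ℝ} (h : PiecewiseContinuous ψ)
    (hs : ∀ s, 0 ≤ s * ψ s) (y : ℝ) : 0 ≤ primitive ψ y := by
  rw [← primitive_zero ψ]
  rcases le_total 0 y with hy | hy
  · exact monotoneOn_primitive h hs self_mem_Ici hy hy
  · exact antitoneOn_primitive h hs hy self_mem_Iic hy

theorem primitive_le_add_neg {ψ : ℝ → ℝ} (h : PiecewiseContinuous ψ)
    (hs : ∀ s, 0 ≤ s * ψ s) {y R : ℝ} (hy : |y| ≤ R) :
    primitive ψ y ≤ primitive ψ R + primitive ψ (-R) := by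
  obtain ⟨h1, h2⟩ := abs_le.1 hy
  have hR : 0 ≤ R := (abs_nonneg y).trans hy
  rcases le_total 0 y with h0 | h0
  · linarith [monotoneOn_primitive h hs h0 hR h2, primitive_nonneg h hs (-R)]
  · linarith [antitoneOn_primitive h hs (neg_nonpos.2 hR) h0 h1, primitive_nonneg h hs R]

/-- Almost every point of a level set at which the derivative exists has zero derivative. -/
theorem ae_deriv_eq_zero_of_eq (y : ℝ → ℝ) (d : ℝ) :
    ∀ᵐ t ∂volume, y t = d → ∀ y', HasDerivAt y y' t → y' = 0 := by
  have hc := countable_setOfPred_isolated_right_within (s := {t | y t = d})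
  filter_upwards [hc.ae_notMem volume] with t ht hyt y' hy'
  by_contra hne
  refine ht ⟨hyt, ?_⟩
  have h1 := hy'.eventually_ne hne (c := d)
  have h2 : ∀ᶠ s in nhdsWithin t ({t | y t = d} ∩ Ioi t), y s ≠ d :=
    h1.filter_mono (nhdsWithin_mono _ fun s hs => ne_of_gt hs.2)
  have h3 : ∀ᶠ s in nhdsWithin t ({t | y t = d} ∩ Ioi t), y s = d := by
    filter_upwards [self_mem_nhdsWithin] with s hs using hs.1
  rw [← Filter.eventually_false_iff_eq_bot]
  filter_upwards [h2, h3] with s a b using a b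

/-- Chain rule along almost every time for the primitive of a piecewise continuous function;
any selection of the Krasovskii regularization serves as the outer derivative. -/
theorem ae_hasDerivAt_primitive_comp {ψ : ℝ → ℝ} (h : PiecewiseContinuous ψ) (y : ℝ → ℝ) :
    ∀ᵐ t ∂volume, ∀ y', HasDerivAt y y' t → ∀ w ∈ kras ψ (y t),
      HasDerivAt (fun t => primitive ψ (y t)) (w * y') t := by
  have h0 : ∀ᵐ t ∂volume, ∀ d ∈ {s | ¬ ContinuousAt ψ s}, y t = d →
      ∀ y', HasDerivAt y y' t → y' = 0 :=
    (ae_ball_iff h.countable).2 fun d _ => ae_deriv_eq_zero_of_eq y d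
  filter_upwards [h0] with t ht y' hy' w hw
  by_cases hc : ContinuousAt ψ (y t)
  · rw [eq_of_mem_kras_of_continuousAt hw hc]
    exact (hasDerivAt_primitive h hc).comp t hy'
  · obtain rfl := ht _ hc rfl y' hy'
    obtain ⟨K, hK⟩ := primitive_lipschitzOn h (y t - 1) (y t + 1)
    rw [mul_zero, hasDerivAt_iff_isLittleO] at *
    simp only [smul_zero, sub_zero] at *
    refine Asymptotics.IsBigO.trans_isLittleO ?_ hy'
    refine Asymptotics.IsBigO.of_bound K ?_
    have hcont : ContinuousAt y t := by
      have : HasDerivAt y 0 t := by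
        rw [hasDerivAt_iff_isLittleO]; simpa using hy'
      exact this.continuousAt
    filter_upwards [hcont (Icc_mem_nhds (sub_one_lt (y t)) (lt_add_one (y t)))] with s hs
    have := hK.dist_le_mul _ hs (y t) ⟨by linarith, by linarith⟩
    simpa [Real.dist_eq] using this

theorem AbsolutelyContinuousOnInterval.congr {f g : ℝ → ℝ} {a b : ℝ}
    (hf : AbsolutelyContinuousOnInterval f a b) (h : EqOn f g (uIcc a b)) :
    AbsolutelyContinuousOnInterval g a b := by
  rw [absolutelyContinuousOnInterval_iff] at *
  intro ε hε
  obtain ⟨δ, hδ, H⟩ := hf ε hε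
  refine ⟨δ, hδ, fun E hE hlt => lt_of_eq_of_lt (Finset.sum_congr rfl fun i hi => ?_)
    (H E hE hlt)⟩
  rw [h (hE.1 i hi).1, h (hE.1 i hi).2]

theorem LipschitzOnWith.comp_absolutelyContinuousOnInterval {g y : ℝ → ℝ} {K : NNReal}
    {S : Set ℝ} {a b : ℝ} (hg : LipschitzOnWith K g S) (hy : AbsolutelyContinuousOnInterval y a b)
    (hS : MapsTo y (uIcc a b) S) : AbsolutelyContinuousOnInterval (fun t => g (y t)) a b := by
  rw [absolutelyContinuousOnInterval_iff] at *
  intro ε hε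
  obtain ⟨δ, hδ, H⟩ := hy (ε / (K + 1)) (by positivity)
  refine ⟨δ, hδ, fun E hE hlt => ?_⟩
  calc _ ≤ ∑ i ∈ Finset.range E.1, K * dist (y (E.2 i).1) (y (E.2 i).2) :=
        Finset.sum_le_sum fun i hi =>
          hg.dist_le_mul _ (hS (hE.1 i hi).1) _ (hS (hE.1 i hi).2)
    _ = K * ∑ i ∈ Finset.range E.1, dist (y (E.2 i).1) (y (E.2 i).2) := by rw [Finset.mul_sum]
    _ ≤ K * (ε / (K + 1)) := by gcongr; exact (H E hE hlt).le
    _ < (K + 1) * (ε / (K + 1)) := by gcongr; linarith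
    _ = ε := by field

theorem absolutelyContinuousOnInterval_primitive_comp {ψ y : ℝ → ℝ}
    (h : PiecewiseContinuous ψ) {a b : ℝ} (hy : AbsolutelyContinuousOnInterval y a b) :
    AbsolutelyContinuousOnInterval (fun t => primitive ψ (y t)) a b := by
  obtain ⟨R, hR⟩ := hy.exists_bound
  obtain ⟨K, hK⟩ := primitive_lipschitzOn h (-R) R
  exact hK.comp_absolutelyContinuousOnInterval hy fun t ht => abs_le.1 (hR t ht)

theorem absolutelyContinuousOnInterval_sum {ι : Type*} (s : Finset ι) {f : ι → ℝ → ℝ} {a b : ℝ}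
    (h : ∀ i ∈ s, AbsolutelyContinuousOnInterval (f i) a b) :
    AbsolutelyContinuousOnInterval (fun t => ∑ i ∈ s, f i t) a b := by
  classical
  induction s using Finset.induction_on with
  | empty =>
    simpa using (LipschitzOnWith.of_dist_le_mul (K := 0) (s := uIcc a b) (f := fun _ => (0 : ℝ))
      (by simp)).absolutelyContinuousOnInterval
  | insert i s hi ih =>
    simp only [Finset.sum_insert hi]
    exact (h i (by simp)).fun_add (ih fun j hj => h j (by simp [hj]))

theorem AbsolutelyContinuousOnInterval.add_integral_le {v g : ℝ → ℝ} {a b : ℝ} (hab : a ≤ b)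
    (hv : AbsolutelyContinuousOnInterval v a b) (hg : IntervalIntegrable g volume a b)
    (h : ∀ᵐ t ∂volume, t ∈ Ioo a b → ∃ v', HasDerivAt v v' t ∧ v' ≤ -g t) :
    v b + ∫ t in a..b, g t ≤ v a := by
  have h1 : ∫ t in a..b, deriv v t ≤ ∫ t in a..b, -g t := by
    refine intervalIntegral.integral_mono_ae_restrict hab hv.intervalIntegrable_deriv hg.neg ?_
    rw [EventuallyLE, ae_restrict_iff' measurableSet_Icc]
    filter_upwards [h, Measure.ae_ne volume a, Measure.ae_ne volume b] with t ht hta htb htI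
    obtain ⟨v', hd, hle⟩ := ht ⟨lt_of_le_of_ne htI.1 (Ne.symm hta), lt_of_le_of_ne htI.2 htb⟩
    rwa [hd.deriv]
  rw [hv.integral_deriv_eq_sub, intervalIntegral.integral_neg] at h1
  linarith

theorem classKL_sqrt_comp {a : ℝ → ℝ} (hcont : Continuous a) (hmono : StrictMonoOn a (Ici 0))
    (h0 : a 0 = 0) {l η : ℝ} (hl : 0 < l) (hη : 0 < η) :
    ClassKL fun s t => √(a (√((s ^ 2 + a s / η) / (1 + t))) / l) := by
  have hnn : ∀ s, 0 ≤ s → 0 ≤ a s := fun s hs =>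
    h0 ▸ hmono.monotoneOn self_mem_Ici hs hs
  have hD : ∀ s, 0 ≤ s → 0 ≤ s ^ 2 + a s / η := fun s hs =>
    add_nonneg (sq_nonneg s) (div_nonneg (hnn s hs) hη.le)
  refine ⟨fun t ht => ⟨?_, ?_, ?_⟩, fun s hs => ⟨?_, ?_⟩⟩
  · refine Continuous.continuousOn ?_
    fun_prop
  · intro u hu v hv huv
    have ht' : 0 < 1 + t := by linarith [show (0 : ℝ) ≤ t from ht]
    have h1 : u ^ 2 + a u / η < v ^ 2 + a v / η :=
      add_lt_add (pow_lt_pow_left₀ huv hu two_ne_zero)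
        (div_lt_div_of_pos_right (hmono hu hv huv) hη)
    have h2 := Real.sqrt_lt_sqrt (div_nonneg (hD u hu) ht'.le)
      (div_lt_div_of_pos_right h1 ht')
    have h3 := hmono (Real.sqrt_nonneg _) (Real.sqrt_nonneg _) h2
    exact Real.sqrt_lt_sqrt (div_nonneg (hnn _ (Real.sqrt_nonneg _)) hl.le)
      (div_lt_div_of_pos_right h3 hl)
  · simp [h0]
  · intro t ht r _ htr
    have ht' : 0 < 1 + t := by linarith [show (0 : ℝ) ≤ t from ht]
    refine Real.sqrt_le_sqrt (div_le_div_of_nonneg_right ?_ hl.le)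
    refine hmono.monotoneOn (Real.sqrt_nonneg _) (Real.sqrt_nonneg _) (Real.sqrt_le_sqrt ?_)
    exact div_le_div_of_nonneg_left (hD s hs) ht' (by linarith)
  · have h1 : Tendsto (fun t : ℝ => (s ^ 2 + a s / η) / (1 + t)) atTop (nhds 0) :=
      tendsto_const_nhds.div_atTop (tendsto_atTop_add_const_left _ _ tendsto_id)
    have h2 : Continuous fun r => √(a (√r) / l) := by fun_prop
    have h3 := (h2.tendsto 0).comp h1
    simp only [Real.sqrt_zero, h0, zero_div] at h3
    exact h3

theorem euclNorm_nonneg {m : ℕ} (x : Fin m → ℝ) : 0 ≤ euclNorm x := Real.sqrt_nonneg _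

theorem euclNorm_sq {m : ℕ} (x : Fin m → ℝ) : euclNorm x ^ 2 = x ⬝ᵥ x := by
  rw [euclNorm, Real.sq_sqrt (Finset.sum_nonneg fun i _ => sq_nonneg (x i))]
  simp [dotProduct, sq]

theorem abs_mulVec_le {m n : ℕ} (C : Matrix (Fin m) (Fin n) ℝ) (x : Fin n → ℝ) (i : Fin m) :
    |(C *ᵥ x) i| ≤ √(∑ i, ∑ j, C i j ^ 2) * euclNorm x := by
  rw [← Real.sqrt_sq_eq_abs, euclNorm, ← Real.sqrt_mul (by positivity)]
  refine Real.sqrt_le_sqrt ?_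
  refine (Finset.sum_mul_sq_le_sq_mul_sq Finset.univ (C i) x).trans ?_
  gcongr
  exact Finset.single_le_sum (f := fun i => ∑ j, C i j ^ 2) (fun i _ => by positivity)
    (Finset.mem_univ i)

theorem dotProduct_mulVec_le {n : ℕ} (P : Matrix (Fin n) (Fin n) ℝ) (x : Fin n → ℝ) :
    x ⬝ᵥ P *ᵥ x ≤ (√(∑ i, ∑ j, P i j ^ 2) * n + 1) * euclNorm x ^ 2 := by
  have h1 : ∀ i, x i * (P *ᵥ x) i ≤ √(∑ i, ∑ j, P i j ^ 2) * euclNorm x ^ 2 := fun i => by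
    have h2 : |x i| ≤ euclNorm x := by
      rw [← Real.sqrt_sq_eq_abs]
      exact Real.sqrt_le_sqrt (Finset.single_le_sum (f := fun i => x i ^ 2)
        (fun i _ => sq_nonneg (x i)) (Finset.mem_univ i))
    calc x i * (P *ᵥ x) i ≤ |x i| * |(P *ᵥ x) i| := by rw [← abs_mul]; exact le_abs_self _
      _ ≤ euclNorm x * (√(∑ i, ∑ j, P i j ^ 2) * euclNorm x) :=
        mul_le_mul h2 (abs_mulVec_le P x i) (abs_nonneg _) (euclNorm_nonneg x)
      _ = _ := by ring
  have h3 : x ⬝ᵥ P *ᵥ x ≤ ∑ _i : Fin n, √(∑ i, ∑ j, P i j ^ 2) * euclNorm x ^ 2 :=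
    Finset.sum_le_sum fun i _ => h1 i
  rw [Finset.sum_const, Finset.card_univ, Fintype.card_fin, nsmul_eq_mul] at h3
  nlinarith [sq_nonneg (euclNorm x)]

theorem Matrix.PosDef.exists_pos_mul_euclNorm_sq_le {n : ℕ} {P : Matrix (Fin n) (Fin n) ℝ}
    (hP : P.PosDef) : ∃ l > 0, ∀ x : Fin n → ℝ, l * euclNorm x ^ 2 ≤ x ⬝ᵥ P *ᵥ x := by
  have hpos : ∀ x : Fin n → ℝ, x ≠ 0 → 0 < x ⬝ᵥ P *ᵥ x := fun x hx => by
    simpa using hP.dotProduct_mulVec_pos hx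
  have hcont : Continuous fun x : Fin n → ℝ => euclNorm x := by
    unfold euclNorm
    fun_prop
  have hq : Continuous fun x : Fin n → ℝ => x ⬝ᵥ P *ᵥ x := by fun_prop
  have hzero : ∀ x : Fin n → ℝ, euclNorm x = 0 → x = 0 := fun x hx => by
    have := euclNorm_sq x
    rw [hx] at this
    exact dotProduct_self_eq_zero.1 (by simpa using this.symm)
  have hsmul : ∀ (c : ℝ) (x : Fin n → ℝ), euclNorm (c • x) = |c| * euclNorm x := fun c x => by
    have : euclNorm (c • x) ^ 2 = (|c| * euclNorm x) ^ 2 := by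
      rw [mul_pow, sq_abs, euclNorm_sq, euclNorm_sq]
      simp [sq, mul_assoc]
    exact (pow_left_inj₀ (euclNorm_nonneg _) (mul_nonneg (abs_nonneg c) (euclNorm_nonneg x))
      two_ne_zero).1 this
  have hcomp : IsCompact {x : Fin n → ℝ | euclNorm x = 1} := by
    refine Metric.isCompact_of_isClosed_isBounded (isClosed_eq hcont continuous_const) ?_
    refine (Metric.isBounded_closedBall (x := (0 : Fin n → ℝ)) (r := 1)).subset fun x hx => ?_
    rw [mem_closedBall_zero_iff, pi_norm_le_iff_of_nonneg zero_le_one]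
    intro i
    rw [Real.norm_eq_abs, ← show euclNorm x = 1 from hx, ← Real.sqrt_sq_eq_abs]
    exact Real.sqrt_le_sqrt (Finset.single_le_sum (f := fun i => x i ^ 2)
        (fun i _ => sq_nonneg (x i)) (Finset.mem_univ i))
  have hmin : ∃ l > 0, ∀ x : Fin n → ℝ, euclNorm x = 1 → l ≤ x ⬝ᵥ P *ᵥ x := by
    rcases {x : Fin n → ℝ | euclNorm x = 1}.eq_empty_or_nonempty with he | hne
    · exact ⟨1, one_pos, fun x hx => absurd (show x ∈ {x | euclNorm x = 1} from hx)
        (by simp [he])⟩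
    · obtain ⟨x₀, hx₀, hm⟩ := hcomp.exists_isMinOn hne hq.continuousOn
      refine ⟨x₀ ⬝ᵥ P *ᵥ x₀, hpos x₀ ?_, fun x hx => hm hx⟩
      rintro rfl
      simp [euclNorm] at hx₀
  obtain ⟨l, hl, H⟩ := hmin
  refine ⟨l, hl, fun x => ?_⟩
  by_cases hx : euclNorm x = 0
  · simp [hzero x hx, euclNorm]
  · have hx' : 0 < euclNorm x := lt_of_le_of_ne (euclNorm_nonneg x) (Ne.symm hx)
    have h1 := H ((euclNorm x)⁻¹ • x) (by rw [hsmul, abs_of_pos (by positivity)]; field_simp)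
    simp only [mulVec_smul, smul_dotProduct, dotProduct_smul, smul_eq_mul] at h1
    rw [← mul_assoc, ← mul_inv, ← sq, inv_mul_eq_div, le_div_iff₀ (by positivity)] at h1
    exact h1

/-- The dissipation inequality encoded by the passivity LMI. -/
theorem dissipation_of_lmi {n p : ℕ} {A : Matrix (Fin n) (Fin n) ℝ}
    {B : Matrix (Fin n) (Fin p) ℝ} {C : Matrix (Fin p) (Fin n) ℝ} {z γ : Fin p → ℝ}
    {P : Matrix (Fin n) (Fin n) ℝ} {η : ℝ} (hPsym : P.IsSymm)
    (hM : ∀ v : Fin n ⊕ Fin p → ℝ,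
      v ⬝ᵥ (Matrix.fromBlocks
        (P * A + Aᵀ * P + η • (1 : Matrix (Fin n) (Fin n) ℝ))
        (P * B - (C + Matrix.diagonal γ * C * A)ᵀ)
        (Bᵀ * P - (C + Matrix.diagonal γ * C * A))
        ((-2 : ℝ) • Matrix.diagonal z - Matrix.diagonal γ * C * B
          - (Matrix.diagonal γ * C * B)ᵀ)).mulVec v ≤ 0)
    (x : Fin n → ℝ) (u : Fin p → ℝ) :
    2 * (x ⬝ᵥ P *ᵥ (A *ᵥ x + B *ᵥ u)) +
      2 * ∑ i, γ i * (-u i * (C *ᵥ (A *ᵥ x + B *ᵥ u)) i) ≤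
    -(η * euclNorm x ^ 2) + 2 * ∑ i, (u i * (C *ᵥ x) i + z i * u i ^ 2) := by
  have ht : ∀ {k l : ℕ} (D : Matrix (Fin k) (Fin l) ℝ) (a : Fin l → ℝ) (b : Fin k → ℝ),
      a ⬝ᵥ Dᵀ *ᵥ b = b ⬝ᵥ D *ᵥ a := fun D a b => by
    rw [mulVec_transpose, dotProduct_comm, dotProduct_mulVec]
  have hP : ∀ a b, a ⬝ᵥ P *ᵥ b = b ⬝ᵥ P *ᵥ a := fun a b => by
    conv_lhs => rw [← hPsym.eq]
    exact ht P a b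
  have h := hM (Sum.elim x u)
  rw [fromBlocks_mulVec, sumElim_dotProduct_sumElim] at h
  simp only [Sum.elim_comp_inl, Sum.elim_comp_inr, add_mulVec, sub_mulVec, dotProduct_add,
    dotProduct_sub, smul_mulVec, dotProduct_smul, transpose_add, one_mulVec, smul_eq_mul,
    ht, ← mulVec_mulVec] at h
  have hPx : ∀ b, P *ᵥ x ⬝ᵥ b = x ⬝ᵥ P *ᵥ b := fun b => by rw [dotProduct_comm, hP]
  simp only [hPx] at h
  have e3 : ∑ i, γ i * (-u i * (C *ᵥ (A *ᵥ x + B *ᵥ u)) i) =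
      -(u ⬝ᵥ diagonal γ *ᵥ (C *ᵥ (A *ᵥ x)) + u ⬝ᵥ diagonal γ *ᵥ (C *ᵥ (B *ᵥ u))) := by
    rw [← dotProduct_add, ← mulVec_add, ← mulVec_add, dotProduct, ← Finset.sum_neg_distrib]
    refine Finset.sum_congr rfl fun i _ => ?_
    rw [mulVec_diagonal]
    ring
  have e4 : ∑ i, (u i * (C *ᵥ x) i + z i * u i ^ 2) =
      u ⬝ᵥ C *ᵥ x + u ⬝ᵥ diagonal z *ᵥ u := by
    rw [← dotProduct_add, dotProduct]
    refine Finset.sum_congr rfl fun i _ => ?_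
    rw [Pi.add_apply, mulVec_diagonal]
    ring
  rw [e3, e4, euclNorm_sq]
  simp only [mulVec_add, dotProduct_add]
  linarith

/-- The Lur'e–Postnikov Lyapunov function. -/
def lurePostnikov {n p : ℕ} (C : Matrix (Fin p) (Fin n) ℝ) (ψ : Fin p → ℝ → ℝ) (γ : Fin p → ℝ)
    (P : Matrix (Fin n) (Fin n) ℝ) (x : Fin n → ℝ) : ℝ :=
  x ⬝ᵥ P *ᵥ x + 2 * ∑ i, γ i * primitive (ψ i) ((C *ᵥ x) i)

theorem HasDerivAt.mulVec_apply {n p : ℕ} (C : Matrix (Fin p) (Fin n) ℝ) {x : ℝ → Fin n → ℝ}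
    {x' : Fin n → ℝ} {t : ℝ} (h : HasDerivAt x x' t) (i : Fin p) :
    HasDerivAt (fun t => (C *ᵥ x t) i) ((C *ᵥ x') i) t := by
  simp only [mulVec, dotProduct]
  exact HasDerivAt.fun_sum fun j _ => ((hasDerivAt_pi.1 h) j).const_mul (C i j)

theorem HasDerivAt.dotProduct_mulVec_self {n : ℕ} {P : Matrix (Fin n) (Fin n) ℝ}
    (hP : P.IsSymm) {x : ℝ → Fin n → ℝ} {x' : Fin n → ℝ} {t : ℝ} (h : HasDerivAt x x' t) :
    HasDerivAt (fun t => x t ⬝ᵥ P *ᵥ x t) (2 * (x t ⬝ᵥ P *ᵥ x')) t := by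
  have h1 : HasDerivAt (fun t => x t ⬝ᵥ P *ᵥ x t)
      (∑ i, (x' i * (P *ᵥ x t) i + x t i * (P *ᵥ x') i)) t :=
    HasDerivAt.fun_sum fun i _ => ((hasDerivAt_pi.1 h) i).mul (h.mulVec_apply P i)
  convert h1 using 1
  rw [Finset.sum_add_distrib]
  have h2 : x' ⬝ᵥ P *ᵥ x t = x t ⬝ᵥ P *ᵥ x' := by
    rw [dotProduct_mulVec, ← mulVec_transpose, hP.eq, dotProduct_comm]
  change _ = x' ⬝ᵥ P *ᵥ x t + x t ⬝ᵥ P *ᵥ x'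
  rw [h2, two_mul]

theorem absolutelyContinuousOnInterval_mulVec {n p : ℕ} (C : Matrix (Fin p) (Fin n) ℝ)
    {x : ℝ → Fin n → ℝ} {a b : ℝ}
    (hx : ∀ i, AbsolutelyContinuousOnInterval (fun t => x t i) a b) (i : Fin p) :
    AbsolutelyContinuousOnInterval (fun t => (C *ᵥ x t) i) a b := by
  simp only [mulVec, dotProduct]
  exact absolutelyContinuousOnInterval_sum _ fun j _ => (hx j).const_mul (C i j)

theorem absolutelyContinuousOnInterval_lurePostnikov {n p : ℕ} (C : Matrix (Fin p) (Fin n) ℝ)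
    {ψ : Fin p → ℝ → ℝ} (hψ : ∀ i, PiecewiseContinuous (ψ i)) (γ : Fin p → ℝ)
    (P : Matrix (Fin n) (Fin n) ℝ) {x : ℝ → Fin n → ℝ} {a b : ℝ}
    (hx : ∀ i, AbsolutelyContinuousOnInterval (fun t => x t i) a b) :
    AbsolutelyContinuousOnInterval (fun t => lurePostnikov C ψ γ P (x t)) a b := by
  unfold lurePostnikov
  refine AbsolutelyContinuousOnInterval.fun_add ?_
    (AbsolutelyContinuousOnInterval.const_mul 2 ?_)
  · have h1 := absolutelyContinuousOnInterval_sum Finset.univ fun i _ =>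
      (hx i).fun_mul (absolutelyContinuousOnInterval_mulVec P hx i)
    exact h1
  · exact absolutelyContinuousOnInterval_sum Finset.univ fun i _ =>
      (absolutelyContinuousOnInterval_primitive_comp (hψ i)
        (absolutelyContinuousOnInterval_mulVec C hx i)).const_mul (γ i)

theorem lurePostnikov_add_integral_le {n p : ℕ} {A : Matrix (Fin n) (Fin n) ℝ}
    {B : Matrix (Fin n) (Fin p) ℝ} {C : Matrix (Fin p) (Fin n) ℝ} {ψ : Fin p → ℝ → ℝ}
    {z γ : Fin p → ℝ} {P : Matrix (Fin n) (Fin n) ℝ} {η : ℝ}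
    (hψ : ∀ i, PiecewiseContinuous (ψ i)) (hsec : ∀ i, Sector (ψ i) (z i)) (hPsym : P.IsSymm)
    (hdiss : ∀ (x : Fin n → ℝ) (u : Fin p → ℝ),
      2 * (x ⬝ᵥ P *ᵥ (A *ᵥ x + B *ᵥ u)) +
        2 * ∑ i, γ i * (-u i * (C *ᵥ (A *ᵥ x + B *ᵥ u)) i) ≤
      -(η * euclNorm x ^ 2) + 2 * ∑ i, (u i * (C *ᵥ x) i + z i * u i ^ 2))
    {x f : ℝ → Fin n → ℝ} {x₀ : Fin n → ℝ} {b : ℝ} (hint : IntervalIntegrable f volume 0 b)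
    (hx : ∀ t, x t = x₀ + ∫ τ in (0 : ℝ)..t, f τ)
    (hf : ∀ᵐ t ∂volume, t ∈ Icc 0 b → f t ∈ lureF A B C ψ (x t)) {s : ℝ} (hs : 0 ≤ s)
    (hsb : s ≤ b) :
    ContinuousOn (fun t => euclNorm (x t)) (Icc 0 b) ∧
    lurePostnikov C ψ γ P (x b) + ∫ t in s..b, η * euclNorm (x t) ^ 2 ≤
      lurePostnikov C ψ γ P (x s) := by
  have hb : 0 ≤ b := hs.trans hsb
  have hxi : ∀ i, AbsolutelyContinuousOnInterval (fun t => x t i) 0 b := fun i => by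
    have hfi : IntervalIntegrable (fun t => f t i) volume 0 b :=
      ⟨hint.1.eval i, hint.2.eval i⟩
    have h1 := hfi.absolutelyContinuousOnInterval_intervalIntegral (c := 0) left_mem_uIcc
    have h2 : AbsolutelyContinuousOnInterval (fun _ => x₀ i) 0 b :=
      (LipschitzOnWith.of_dist_le_mul (K := 0) (by simp)).absolutelyContinuousOnInterval
    refine (h2.fun_add h1).congr fun t ht => ?_
    have hft : IntervalIntegrable f volume 0 t := hint.mono_set (uIcc_subset_uIcc_left ht)
    have h3 := (ContinuousLinearMap.proj (R := ℝ) (φ := fun _ : Fin n => ℝ)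
      i).intervalIntegral_comp_comm hft
    simp only [ContinuousLinearMap.proj_apply] at h3
    simp only [hx t, Pi.add_apply, h3]
  have hV := absolutelyContinuousOnInterval_lurePostnikov C hψ γ P hxi
  have hcont : ContinuousOn (fun t => euclNorm (x t)) (Icc 0 b) := by
    have : ∀ i, ContinuousOn (fun t => x t i) (Icc 0 b) := fun i => by
      simpa [uIcc_of_le hb] using (hxi i).continuousOn
    unfold euclNorm
    fun_prop
  refine ⟨hcont, ?_⟩
  have hsub : Icc s b ⊆ Icc 0 b := Icc_subset_Icc_left hs
  refine (hV.mono (by rwa [uIcc_of_le hb, uIcc_of_le hsb])).add_integral_le hsb ?_ ?_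
  · refine ContinuousOn.intervalIntegrable ?_
    rw [uIcc_of_le hsb]
    exact ((hcont.mono hsub).pow 2).const_mul η |>.congr fun _ _ => rfl
  · have hchain : ∀ᵐ t ∂volume, ∀ i, ∀ y', HasDerivAt (fun t => (C *ᵥ x t) i) y' t →
        ∀ w ∈ kras (ψ i) ((C *ᵥ x t) i),
        HasDerivAt (fun t => primitive (ψ i) ((C *ᵥ x t) i)) (w * y') t :=
      ae_all_iff.2 fun i => ae_hasDerivAt_primitive_comp (hψ i) _
    filter_upwards [hf, hchain, hint.ae_hasDerivAt_integral] with t hft hct hdt ht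
    have htI : t ∈ Icc 0 b := hsub ⟨ht.1.le, ht.2.le⟩
    obtain ⟨u, hu, hfu⟩ := hft htI
    have hd : HasDerivAt x (f t) t := by
      rw [funext hx]
      exact (hdt (by rwa [uIcc_of_le hb]) 0 left_mem_uIcc).const_add x₀
    refine ⟨2 * (x t ⬝ᵥ P *ᵥ f t) + 2 * ∑ i, γ i * (-u i * (C *ᵥ f t) i),
      (hd.dotProduct_mulVec_self hPsym).add ((HasDerivAt.fun_sum fun i _ =>
        (hct i _ (hd.mulVec_apply C i) _ (hu i)).const_mul (γ i)).const_mul 2), ?_⟩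
    have h1 := hdiss (x t) u
    rw [← hfu] at h1
    have h2 : ∑ i, (u i * (C *ᵥ x t) i + z i * u i ^ 2) ≤ 0 :=
      Finset.sum_nonpos fun i _ => by
        have := kras_sector (hsec i).mul_sq_le.1 (hsec i).mul_sq_le.2 (hu i)
        simp only [neg_sq] at this
        linarith
    linarith

/-- Under Assumption 1 (sector condition) and Assumption 2
(strict passivity LMI), the origin of the regularized Lur'e system is GAS. -/
theorem stmt0 {n p : ℕ} (A : Matrix (Fin n) (Fin n) ℝ) (B : Matrix (Fin n) (Fin p) ℝ)
    (C : Matrix (Fin p) (Fin n) ℝ) (ψ : Fin p → ℝ → ℝ) (z : Fin p → ℝ)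
    (γ : Fin p → ℝ) (P : Matrix (Fin n) (Fin n) ℝ) (η : ℝ)
    -- Assumption 1
    (hA1 : ∀ i, PiecewiseContinuous (ψ i) ∧ Sector (ψ i) (z i))
    -- Assumption 2
    (hγ : ∀ i, 0 < γ i) (hPsym : P.IsSymm) (hPpos : P.PosDef) (hη : 0 < η)
    (hM : ∀ v : Fin n ⊕ Fin p → ℝ,
      v ⬝ᵥ (Matrix.fromBlocks
        (P * A + Aᵀ * P + η • (1 : Matrix (Fin n) (Fin n) ℝ))
        (P * B - (C + Matrix.diagonal γ * C * A)ᵀ)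
        (Bᵀ * P - (C + Matrix.diagonal γ * C * A))
        ((-2 : ℝ) • Matrix.diagonal z - Matrix.diagonal γ * C * B
          - (Matrix.diagonal γ * C * B)ᵀ)).mulVec v ≤ 0) :
    ∃ β : ℝ → ℝ → ℝ, ClassKL β ∧
      ∀ T : ℝ≥0∞, ∀ x : ℝ → Fin n → ℝ,
        IsKrasovskiiSolutionOn (lureF A B C ψ) x (timeItv T) →
        ∀ t ∈ timeItv T, euclNorm (x t) ≤ β (euclNorm (x 0)) t := by
  have hψ := fun i => (hA1 i).1
  have hsec := fun i => (hA1 i).2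
  have hsign : ∀ i s, 0 ≤ s * ψ i s := fun i s =>
    (mul_nonneg (hsec i).mul_sq_le.1 (sq_nonneg _)).trans ((hsec i).mul_sq_le.2 s)
  obtain ⟨l, hl, hlow⟩ := hPpos.exists_pos_mul_euclNorm_sq_le
  set c : ℝ := √(∑ i, ∑ j, C i j ^ 2) with hc
  set k : ℝ := √(∑ i, ∑ j, P i j ^ 2) * n + 1 with hk
  have hc0 : 0 ≤ c := Real.sqrt_nonneg _
  have hk0 : 0 < k := by positivity
  set a : ℝ → ℝ := fun r => k * r ^ 2 +
    2 * ∑ i, γ i * (primitive (ψ i) (c * r) + primitive (ψ i) (-(c * r))) with ha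
  have hacont : Continuous a := by
    have := fun i => continuous_primitive (hψ i)
    fun_prop
  have ha0 : a 0 = 0 := by simp [ha, primitive_zero]
  have hamono : StrictMonoOn a (Ici 0) := by
    intro r hr s hs hrs
    have hcrs : c * r ≤ c * s := mul_le_mul_of_nonneg_left hrs.le hc0
    have hcr : 0 ≤ c * r := mul_nonneg hc0 hr
    refine add_lt_add_of_lt_of_le
      (mul_lt_mul_of_pos_left (pow_lt_pow_left₀ hrs hr two_ne_zero) hk0) ?_
    refine mul_le_mul_of_nonneg_left (Finset.sum_le_sum fun i _ =>
      mul_le_mul_of_nonneg_left (add_le_add ?_ ?_) (hγ i).le) zero_le_two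
    · exact monotoneOn_primitive (hψ i) (hsign i) hcr (hcr.trans hcrs) hcrs
    · exact antitoneOn_primitive (hψ i) (hsign i) (neg_nonpos.2 (hcr.trans hcrs))
        (neg_nonpos.2 hcr) (neg_le_neg hcrs)
  have hVlow : ∀ y, l * euclNorm y ^ 2 ≤ lurePostnikov C ψ γ P y := fun y =>
    (hlow y).trans (le_add_of_nonneg_right (mul_nonneg zero_le_two (Finset.sum_nonneg fun i _ =>
      mul_nonneg (hγ i).le (primitive_nonneg (hψ i) (hsign i) _))))
  have hVup : ∀ y, lurePostnikov C ψ γ P y ≤ a (euclNorm y) := fun y =>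
    add_le_add (dotProduct_mulVec_le P y) (mul_le_mul_of_nonneg_left (Finset.sum_le_sum fun i _ =>
      mul_le_mul_of_nonneg_left
        (primitive_le_add_neg (hψ i) (hsign i) (abs_mulVec_le C y i)) (hγ i).le) zero_le_two)
  refine ⟨_, classKL_sqrt_comp hacont hamono ha0 hl hη, ?_⟩
  rintro T x ⟨f, hint, hf, hx⟩ t ht
  have hsub : ∀ τ ∈ Icc 0 t, τ ∈ timeItv T := fun τ hτ =>
    ⟨hτ.1, (ENNReal.ofReal_le_ofReal hτ.2).trans_lt ht.2⟩
  set X : ℝ → Fin n → ℝ := fun t => x 0 + ∫ τ in (0 : ℝ)..t, f τ with hX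
  have hxX : ∀ τ ∈ Icc 0 t, x τ = X τ := fun τ hτ => hx τ (hsub τ hτ)
  have hfX : ∀ᵐ τ ∂volume, τ ∈ Icc 0 t → f τ ∈ lureF A B C ψ (X τ) := by
    filter_upwards [hf] with τ h hτ
    rw [← hxX τ hτ]
    exact h (hsub τ hτ)
  have hdec : ∀ s ∈ Icc 0 t, _ := fun s hs =>
    lurePostnikov_add_integral_le hψ hsec hPsym (dissipation_of_lmi (γ := γ) hPsym hM)
      (hint t ht) (fun τ => rfl) hfX hs.1 hs.2
  have h0t : (0 : ℝ) ∈ Icc 0 t := ⟨le_rfl, ht.1⟩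
  have htt : t ∈ Icc 0 t := ⟨ht.1, le_rfl⟩
  have hX0 : X 0 = x 0 := (hxX 0 h0t).symm
  have hcont : ContinuousOn (fun τ => euclNorm (X τ)) (Icc 0 t) := (hdec 0 h0t).1
  rw [hxX t htt]
  set r := euclNorm (x 0) with hr
  set D := r ^ 2 + a r / η with hD
  have ht1 : 0 < 1 + t := by linarith [ht.1]
  have har : 0 ≤ a r :=
    ha0 ▸ hamono.monotoneOn self_mem_Ici (euclNorm_nonneg _) (euclNorm_nonneg _)
  -- The squared norm must drop below `D / (1 + t)` at some earlier time.
  obtain ⟨τ, hτ, hτD⟩ : ∃ τ ∈ Icc 0 t, euclNorm (X τ) ^ 2 ≤ D / (1 + t) := by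
    by_contra! hcon
    have h1 := hcon 0 h0t
    rw [hX0] at h1
    have h2 : ∫ _τ in (0 : ℝ)..t, η * (D / (1 + t)) ≤
        ∫ τ in (0 : ℝ)..t, η * euclNorm (X τ) ^ 2 := by
      refine intervalIntegral.integral_mono_on ht.1 (by simp) ?_ fun τ hτ =>
        mul_le_mul_of_nonneg_left (hcon τ hτ).le hη.le
      refine ContinuousOn.intervalIntegrable ?_
      rw [uIcc_of_le ht.1]
      exact continuousOn_const.mul (hcont.pow 2)
    rw [intervalIntegral.integral_const, sub_zero, smul_eq_mul] at h2
    have h3 := (hdec 0 h0t).2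
    have h4 : lurePostnikov C ψ γ P (X 0) ≤ a r := by rw [hX0]; exact hVup _
    have h5 : 0 ≤ lurePostnikov C ψ γ P (X t) :=
      (mul_nonneg hl.le (sq_nonneg _)).trans (hVlow _)
    have h6 : t * (D / (1 + t)) ≤ a r / η := by
      rw [le_div_iff₀ hη]
      linarith
    have h7 : (1 + t) * (D / (1 + t)) = D := by field_simp
    linarith
  have h1 : lurePostnikov C ψ γ P (X t) ≤ lurePostnikov C ψ γ P (X τ) := by
    have h2 : 0 ≤ ∫ s in τ..t, η * euclNorm (X s) ^ 2 :=
      intervalIntegral.integral_nonneg hτ.2 fun s _ => by positivity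
    linarith [(hdec τ hτ).2]
  refine Real.le_sqrt_of_sq_le ?_
  rw [le_div_iff₀ hl, mul_comm]
  refine (hVlow _).trans (h1.trans ((hVup _).trans ?_))
  exact hamono.monotoneOn (euclNorm_nonneg _) (Real.sqrt_nonneg _) (Real.le_sqrt_of_sq_le hτD)
end
end

section
/- Let A ∈ ℝ^{n×n}, B ∈ ℝ^{n×p}, C ∈ ℝ^{p×n}, Γ ∈ ℝ^{p×p} diagonal, Z ∈ ℝ^{p×p} diagonal with nonnegative entries, P ∈ ℝ^{n×n} symmetric, and η > 0 be such that the block matrix M := [[PA + AᵀP + ηIₙ, PB − (C + ΓCA)ᵀ], [BᵀP − (C + ΓCA), −2Z − ΓCB − (ΓCB)ᵀ]] is negative semidefinite. Then for every x ∈ ℝⁿ and every u ∈ ℝᵖ with uᵀ(Zu + Cx) ≤ 0, one has (xᵀP − uᵀΓC)(Ax + Bu) ≤ −(η/2)|x|². -/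
open Matrix MeasureTheory Filter Set
open scoped ENNReal

noncomputable section

/-- A bilinear form evaluated through the transpose of its matrix. -/
theorem dotProduct_transpose_mulVec_comm {m k R : Type*} [Fintype m] [Fintype k] [CommSemiring R]
    (M : Matrix m k R) (x : k → R) (y : m → R) :
    x ⬝ᵥ Mᵀ *ᵥ y = y ⬝ᵥ M *ᵥ x := by
  rw [mulVec_transpose, dotProduct_comm, ← dotProduct_mulVec]

/-- if the LMI matrix `M` is negative semidefinite, then for all
`x` and all `u` with `uᵀ(Zu + Cx) ≤ 0`, one has
`(xᵀP - uᵀΓC)(Ax + Bu) ≤ -(η/2)|x|²`. -/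
theorem stmt3 {n p : ℕ} (A : Matrix (Fin n) (Fin n) ℝ) (B : Matrix (Fin n) (Fin p) ℝ)
    (C : Matrix (Fin p) (Fin n) ℝ) (g z : Fin p → ℝ) (P : Matrix (Fin n) (Fin n) ℝ)
    (η : ℝ) (hz : ∀ i, 0 ≤ z i) (hPsym : P.IsSymm) (hη : 0 < η)
    (hM : ∀ v : Fin n ⊕ Fin p → ℝ,
      v ⬝ᵥ (Matrix.fromBlocks
        (P * A + Aᵀ * P + η • (1 : Matrix (Fin n) (Fin n) ℝ))
        (P * B - (C + Matrix.diagonal g * C * A)ᵀ)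
        (Bᵀ * P - (C + Matrix.diagonal g * C * A))
        ((-2 : ℝ) • Matrix.diagonal z - Matrix.diagonal g * C * B
          - (Matrix.diagonal g * C * B)ᵀ)).mulVec v ≤ 0) :
    ∀ (x : Fin n → ℝ) (u : Fin p → ℝ),
      u ⬝ᵥ ((Matrix.diagonal z).mulVec u + C.mulVec x) ≤ 0 →
      (Matrix.vecMul x P - Matrix.vecMul u (Matrix.diagonal g * C)) ⬝ᵥ
          (A.mulVec x + B.mulVec u)
        ≤ -(η / 2) * euclNorm x ^ 2 := by
  intro x u hu
  have h := hM (Sum.elim x u)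
  have hPA : x ⬝ᵥ (Aᵀ * P) *ᵥ x = x ⬝ᵥ (P * A) *ᵥ x := by
    rw [← dotProduct_transpose_mulVec_comm (P * A), transpose_mul, hPsym.eq]
  have hPB : u ⬝ᵥ (Bᵀ * P) *ᵥ x = x ⬝ᵥ (P * B) *ᵥ u := by
    rw [← dotProduct_transpose_mulVec_comm (P * B), transpose_mul, hPsym.eq]
  rw [fromBlocks_mulVec, sumElim_dotProduct_sumElim] at h
  simp only [Sum.elim_comp_inl, Sum.elim_comp_inr, add_mulVec, sub_mulVec, smul_mulVec,
    one_mulVec, dotProduct_add, dotProduct_sub, dotProduct_smul, smul_eq_mul,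
    dotProduct_transpose_mulVec_comm, hPA, hPB] at h
  rw [dotProduct_add] at hu
  rw [euclNorm_sq]
  simp only [sub_dotProduct, dotProduct_add, ← dotProduct_mulVec, mulVec_mulVec]
  linarith
end
end

section
/- Let ψ : ℝ → ℝ and ζ ∈ (0, ∞) satisfy the sector condition ψ(s)(ψ(s) − ζs) ≤ 0 for all s ∈ ℝ. Then for every y ∈ ℝ and every v in the Krasovskii regularization Ψ(y), one has v(v − ζy) ≤ 0. Moreover, if ψ satisfies s·ψ(s) ≥ 0 for all s ∈ ℝ, then y·v ≥ 0 for every y ∈ ℝ and every v ∈ Ψ(y). -/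
open Matrix MeasureTheory Filter Set
open scoped ENNReal

noncomputable section

theorem kras_subset_of_mapsTo {ψ : ℝ → ℝ} {y δ : ℝ} {K : Set ℝ} (hδ : 0 < δ)
    (hclosed : IsClosed K) (hconvex : Convex ℝ K)
    (hmaps : MapsTo ψ (Set.Icc (y - δ) (y + δ)) K) : kras ψ y ⊆ K := by
  intro v hv
  exact closure_minimal (convexHull_min hmaps.image_subset hconvex) hclosed
    (Set.mem_iInter₂.mp hv δ hδ)

theorem mul_sub_nonpos_iff_mem_uIcc {a b : ℝ} : a * (a - b) ≤ 0 ↔ a ∈ Set.uIcc 0 b := by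
  rw [Set.mem_uIcc, mul_nonpos_iff, sub_nonpos, sub_nonneg]
  tauto

theorem kras_subset_uIcc {ψ : ℝ → ℝ} {ζ : ℝ} (hζ : 0 < ζ)
    (hsec : ∀ s : ℝ, ψ s ∈ Set.uIcc 0 (ζ * s)) (y : ℝ) :
    kras ψ y ⊆ Set.uIcc 0 (ζ * y) := by
  intro v hv
  have hε : ∀ ε > 0, v ∈ Set.Icc (min 0 (ζ * y) - ε) (max 0 (ζ * y) + ε) := by
    intro ε hε
    refine kras_subset_of_mapsTo (div_pos hε hζ) isClosed_Icc (convex_Icc _ _) ?_ hv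
    rintro s ⟨hs₁, hs₂⟩
    have h₁ := mul_le_mul_of_nonneg_left hs₁ hζ.le
    have h₂ := mul_le_mul_of_nonneg_left hs₂ hζ.le
    rw [mul_sub, mul_div_cancel₀ _ hζ.ne'] at h₁
    rw [mul_add, mul_div_cancel₀ _ hζ.ne'] at h₂
    obtain ⟨hl, hu⟩ := hsec s
    constructor
    · refine le_trans (le_min ?_ ?_) hl
      · linarith [min_le_left 0 (ζ * y)]
      · linarith [min_le_right 0 (ζ * y)]
    · refine hu.trans (max_le ?_ ?_)
      · linarith [le_max_left 0 (ζ * y)]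
      · linarith [le_max_right 0 (ζ * y)]
  exact ⟨le_of_forall_pos_le_add fun ε h => by linarith [(hε ε h).1],
    le_of_forall_pos_le_add fun ε h => (hε ε h).2⟩

theorem mul_nonneg_of_mem_kras {ψ : ℝ → ℝ} (hψ : ∀ s : ℝ, 0 ≤ s * ψ s) {y v : ℝ}
    (hv : v ∈ kras ψ y) : 0 ≤ y * v := by
  rcases lt_trichotomy y 0 with hy | rfl | hy
  · refine mul_nonneg_of_nonpos_of_nonpos hy.le ?_
    refine kras_subset_of_mapsTo (δ := -y / 2) (by linarith) isClosed_Iic (convex_Iic 0) ?_ hv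
    rintro s ⟨-, hs⟩
    exact nonpos_of_mul_nonneg_right (hψ s) (by linarith)
  · simp
  · refine mul_nonneg hy.le ?_
    refine kras_subset_of_mapsTo (δ := y / 2) (by linarith) isClosed_Ici (convex_Ici 0) ?_ hv
    rintro s ⟨hs, -⟩
    exact nonneg_of_mul_nonneg_right (hψ s) (by linarith)

/-- the sector condition is preserved by Krasovskii
regularization; the same holds for the infinite-sector condition. -/
theorem stmt4 (ψ : ℝ → ℝ) (ζ : ℝ) (hζ : 0 < ζ)
    (hsec : ∀ s : ℝ, ψ s * (ψ s - ζ * s) ≤ 0) :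
    (∀ y : ℝ, ∀ v ∈ kras ψ y, v * (v - ζ * y) ≤ 0) ∧
    ((∀ s : ℝ, 0 ≤ s * ψ s) → ∀ y : ℝ, ∀ v ∈ kras ψ y, 0 ≤ y * v) := by
  refine ⟨fun y v hv => mul_sub_nonpos_iff_mem_uIcc.mpr ?_,
    fun hψ y v hv => mul_nonneg_of_mem_kras hψ hv⟩
  exact kras_subset_uIcc hζ (fun s => mul_sub_nonpos_iff_mem_uIcc.mp (hsec s)) y hv
end
end

section
/- Consider the regularized Lur'e system ẋ ∈ F(x) with F(x) := {Ax + Bu : u ∈ −ΨΨ(Cx)} and suppose Assumptions 1 and 3 hold. Then the system is output finite-time stable: there exists a class-KL function β such that every Krasovskii solution x : [0,∞) → ℝⁿ satisfies |Cx(t)| ≤ β(|x(0)|, t) for all t ≥ 0, and for every Krasovskii solution x : [0,∞) → ℝⁿ there exists T ∈ [0,∞) such that Cx(t) = 0 for all t ≥ T. -/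
open Matrix MeasureTheory Filter Set
open scoped ENNReal

noncomputable section

/-- Postcomposition with a Lipschitz map preserves absolute continuity. -/
theorem absolutelyContinuousOnInterval_lipschitz_comp {φ : ℝ → ℝ} {K : NNReal} {f : ℝ → ℝ}
    {a b : ℝ} (hφ : LipschitzWith K φ) (hf : AbsolutelyContinuousOnInterval f a b) :
    AbsolutelyContinuousOnInterval (fun t => φ (f t)) a b := by
  rw [absolutelyContinuousOnInterval_iff] at hf ⊢
  intro ε hε
  have hK : (0 : ℝ) < K + 1 := by positivity
  obtain ⟨δ, hδ, h⟩ := hf (ε / (K + 1)) (by positivity)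
  refine ⟨δ, hδ, fun E hE hEδ => ?_⟩
  have h1 := h E hE hEδ
  rw [lt_div_iff₀ hK] at h1
  calc ∑ i ∈ Finset.range E.1, dist (φ (f (E.2 i).1)) (φ (f (E.2 i).2))
      ≤ ∑ i ∈ Finset.range E.1, dist (f (E.2 i).1) (f (E.2 i).2) * (K + 1) := by
        gcongr with i
        have h2 := hφ.dist_le_mul (f (E.2 i).1) (f (E.2 i).2)
        nlinarith [dist_nonneg (x := f (E.2 i).1) (y := f (E.2 i).2)]
    _ = (∑ i ∈ Finset.range E.1, dist (f (E.2 i).1) (f (E.2 i).2)) * (K + 1) := by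
        rw [Finset.sum_mul]
    _ < ε := h1

/-- Finitely many absolutely continuous functions whose derivatives sum to at most `-k` almost
everywhere decrease, in total, at rate at least `k`. -/
theorem sum_le_sub_of_ae_sum_deriv_le {ι : Type*} [Fintype ι] {φ : ι → ℝ → ℝ} {a b k : ℝ}
    (hab : a ≤ b) (hφ : ∀ i, AbsolutelyContinuousOnInterval (φ i) a b)
    (h : ∀ᵐ t ∂volume, t ∈ Icc a b → ∑ i, deriv (φ i) t ≤ -k) :
    ∑ i, φ i b ≤ ∑ i, φ i a - k * (b - a) := by
  have hint : ∀ i, IntervalIntegrable (deriv (φ i)) volume a b :=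
    fun i => (hφ i).intervalIntegrable_deriv
  have h1 : ∫ t in a..b, ∑ i, deriv (φ i) t = ∑ i, φ i b - ∑ i, φ i a := by
    rw [intervalIntegral.integral_finsetSum fun i _ => hint i, ← Finset.sum_sub_distrib]
    exact Finset.sum_congr rfl fun i _ => (hφ i).integral_deriv_eq_sub
  have hsum : IntervalIntegrable (fun t => ∑ i, deriv (φ i) t) volume a b := by
    simpa only [Finset.sum_fn] using IntervalIntegrable.sum Finset.univ fun i _ => hint i
  have h2 : ∫ t in a..b, ∑ i, deriv (φ i) t ≤ ∫ _ in a..b, (-k) := by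
    refine intervalIntegral.integral_mono_ae_restrict hab hsum intervalIntegrable_const ?_
    exact (ae_restrict_iff' measurableSet_Icc).2 h
  rw [h1, intervalIntegral.integral_const, smul_eq_mul] at h2
  linarith

/-- Chain rule for `r ↦ max (a * r) (b * r)` along a differentiable function. At a zero of `y`
differentiability forces both derivatives to vanish, so the multiplier `v` is arbitrary. -/
theorem hasDerivAt_max_mul_eq {y : ℝ → ℝ} {a b y' d v t : ℝ} (ha : 0 < a) (hb : b < 0)
    (hy : HasDerivAt y y' t) (hd : HasDerivAt (fun s => max (a * y s) (b * y s)) d t)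
    (hpos : 0 < y t → v = a) (hneg : y t < 0 → v = b) : d = v * y' := by
  have hda : 0 ≤ y t → d = a * y' := fun h => by
    have hmin : IsLocalMin (fun s => max (a * y s) (b * y s) - a * y s) t := by
      refine Filter.Eventually.of_forall fun s => ?_
      have h1 : max (a * y t) (b * y t) = a * y t := max_eq_left (by nlinarith)
      have h2 := le_max_left (a * y s) (b * y s)
      simp only [h1]
      linarith
    linarith [hmin.hasDerivAt_eq_zero (hd.sub (hy.const_mul a))]
  have hdb : y t ≤ 0 → d = b * y' := fun h => by
    have hmin : IsLocalMin (fun s => max (a * y s) (b * y s) - b * y s) t := by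
      refine Filter.Eventually.of_forall fun s => ?_
      have h1 : max (a * y t) (b * y t) = b * y t := max_eq_right (by nlinarith)
      have h2 := le_max_right (a * y s) (b * y s)
      simp only [h1]
      linarith
    linarith [hmin.hasDerivAt_eq_zero (hd.sub (hy.const_mul b))]
  rcases lt_trichotomy (y t) 0 with h | h | h
  · rw [hneg h, hdb h.le]
  · have h1 := hda h.ge
    have h2 := hdb h.le
    have h3 : (a - b) * y' = 0 := by linarith
    have h4 : y' = 0 := by
      rcases mul_eq_zero.1 h3 with h5 | h5
      · linarith
      · exact h5
    rw [h1, h4]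
    ring
  · rw [hpos h, hda h.le]

theorem kras_subset_Icc {ψ : ℝ → ℝ} {y δ l u : ℝ} (hδ : 0 < δ)
    (h : ∀ s ∈ Icc (y - δ) (y + δ), ψ s ∈ Icc l u) : kras ψ y ⊆ Icc l u := by
  intro w hw
  have h1 : w ∈ closure (convexHull ℝ (ψ '' Icc (y - δ) (y + δ))) := by
    unfold kras at hw
    exact mem_iInter₂.1 hw δ hδ
  exact closure_minimal (convexHull_min (forall_mem_image.2 h) (convex_Icc l u)) isClosed_Icc h1

/-- Near the right (left) of a point with a one-sided limit, the regularization is close to it. -/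
theorem exists_kras_near {ψ : ℝ → ℝ} {a b ε : ℝ} (hε : 0 < ε)
    (ha : Tendsto ψ (nhdsWithin 0 (Ioi 0)) (nhds a))
    (hb : Tendsto ψ (nhdsWithin 0 (Iio 0)) (nhds b)) :
    ∃ η > 0, ∀ y w : ℝ, |y| < η → w ∈ kras ψ y →
      (0 < y → |w - a| ≤ ε) ∧ (y < 0 → |w - b| ≤ ε) := by
  have h1 := ha (Icc_mem_nhds (sub_lt_self a hε) (lt_add_of_pos_right a hε))
  have h2 := hb (Icc_mem_nhds (sub_lt_self b hε) (lt_add_of_pos_right b hε))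
  obtain ⟨η₁, hη₁, h1⟩ := mem_nhdsGT_iff_exists_Ioo_subset.1 h1
  obtain ⟨η₂, hη₂, h2⟩ := mem_nhdsLT_iff_exists_Ioo_subset.1 h2
  simp only [mem_Ioi, mem_Iio] at hη₁ hη₂
  refine ⟨min η₁ (-η₂), lt_min hη₁ (by linarith), fun y w hy hw => ⟨fun h => ?_, fun h => ?_⟩⟩
  · rw [abs_of_pos h, lt_min_iff] at hy
    have h3 : kras ψ y ⊆ Icc (a - ε) (a + ε) := by
      refine kras_subset_Icc (δ := min (y / 2) ((η₁ - y) / 2))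
        (lt_min (by linarith) (by linarith)) fun s hs => h1 ?_
      have h4 := min_le_left (y / 2) ((η₁ - y) / 2)
      have h5 := min_le_right (y / 2) ((η₁ - y) / 2)
      exact ⟨by linarith [hs.1], by linarith [hs.2]⟩
    have := h3 hw
    exact abs_le.2 ⟨by linarith [this.1], by linarith [this.2]⟩
  · rw [abs_of_neg h, lt_min_iff] at hy
    have h3 : kras ψ y ⊆ Icc (b - ε) (b + ε) := by
      refine kras_subset_Icc (δ := min (-y / 2) ((y - η₂) / 2))
        (lt_min (by linarith) (by linarith)) fun s hs => h2 ?_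
      have h4 := min_le_left (-y / 2) ((y - η₂) / 2)
      have h5 := min_le_right (-y / 2) ((y - η₂) / 2)
      exact ⟨by linarith [hs.1], by linarith [hs.2]⟩
    have := h3 hw
    exact abs_le.2 ⟨by linarith [this.1], by linarith [this.2]⟩

/-- Lyapunov diagonal stability gives a uniform quadratic lower bound. -/
theorem exists_quadratic_lower_bound {p : ℕ} {M : Matrix (Fin p) (Fin p) ℝ} {γ : Fin p → ℝ}
    (hM : ∀ u : Fin p → ℝ, u ≠ 0 →
      0 < u ⬝ᵥ ((Matrix.diagonal γ * M + Mᵀ * Matrix.diagonal γ).mulVec u)) :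
    ∃ c > 0, ∀ u : Fin p → ℝ, c * ‖u‖ ^ 2 ≤ ∑ i, γ i * (u i * (M.mulVec u) i) := by
  have hq : ∀ u : Fin p → ℝ,
      u ⬝ᵥ ((Matrix.diagonal γ * M + Mᵀ * Matrix.diagonal γ).mulVec u) =
        2 * ∑ i, γ i * (u i * (M.mulVec u) i) := by
    intro u
    have h1 : u ⬝ᵥ ((Matrix.diagonal γ * M).mulVec u) = ∑ i, γ i * (u i * (M.mulVec u) i) := by
      rw [← Matrix.mulVec_mulVec, dotProduct]
      refine Finset.sum_congr rfl fun i _ => ?_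
      rw [Matrix.mulVec_diagonal]
      ring
    have h2 : Mᵀ * Matrix.diagonal γ = (Matrix.diagonal γ * M)ᵀ := by
      rw [Matrix.transpose_mul, Matrix.diagonal_transpose]
    rw [Matrix.add_mulVec, dotProduct_add, h2, Matrix.mulVec_transpose,
      dotProduct_comm u (vecMul _ _), ← Matrix.dotProduct_mulVec, h1]
    ring
  have hcont : Continuous fun u : Fin p → ℝ => ∑ i, γ i * (u i * (M.mulVec u) i) := by
    simp only [Matrix.mulVec, dotProduct]
    fun_prop
  obtain ⟨c, hc, h⟩ := (isCompact_sphere (0 : Fin p → ℝ) 1).exists_forall_le' hcont.continuousOn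
    (a := 0) fun u hu => by
      have hu0 : u ≠ 0 := by
        rintro rfl
        simp at hu
      have := hM u hu0
      rw [hq] at this
      linarith
  refine ⟨c, hc, fun u => ?_⟩
  rcases eq_or_ne u 0 with rfl | hu
  · simp
  have hn : ‖u‖ ≠ 0 := norm_ne_zero_iff.2 hu
  have h1 := h (‖u‖⁻¹ • u) (by simp [norm_smul, hn])
  have h2 : ∑ i, γ i * ((‖u‖⁻¹ • u) i * (M.mulVec (‖u‖⁻¹ • u)) i) =
      (‖u‖ ^ 2)⁻¹ * ∑ i, γ i * (u i * (M.mulVec u) i) := by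
    rw [Finset.mul_sum]
    refine Finset.sum_congr rfl fun i _ => ?_
    rw [Matrix.mulVec_smul]
    simp only [Pi.smul_apply, smul_eq_mul]
    ring
  rw [h2, inv_mul_eq_div, le_div_iff₀ (by positivity)] at h1
  exact h1

/-- A coercive quadratic form dominates a small linear perturbation away from the origin. -/
theorem exists_dissipation {p : ℕ} {M : Matrix (Fin p) (Fin p) ℝ} {γ : Fin p → ℝ} {m : ℝ}
    (hm : 0 < m) (hγ : ∀ i, 0 < γ i)
    (hM : ∀ u : Fin p → ℝ, u ≠ 0 →
      0 < u ⬝ᵥ ((Matrix.diagonal γ * M + Mᵀ * Matrix.diagonal γ).mulVec u)) :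
    ∃ δ > 0, ∃ k > 0, ∀ v r : Fin p → ℝ, m ≤ ‖v‖ → ‖r‖ ≤ δ →
      ∑ i, γ i * (v i * (r i - (M.mulVec v) i)) ≤ -k := by
  obtain ⟨c, hc, hq⟩ := exists_quadratic_lower_bound hM
  have hS : 0 ≤ ∑ i, γ i := Finset.sum_nonneg fun i _ => (hγ i).le
  refine ⟨c * m / (2 * (∑ i, γ i + 1)), by positivity, c * m ^ 2 / 2, by positivity,
    fun v r hv hr => ?_⟩
  have h1 : ∑ i, γ i * (v i * r i) ≤ (∑ i, γ i) * (‖v‖ * ‖r‖) := by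
    rw [Finset.sum_mul]
    refine Finset.sum_le_sum fun i _ => mul_le_mul_of_nonneg_left ?_ (hγ i).le
    calc v i * r i ≤ |v i * r i| := le_abs_self _
      _ = ‖v i‖ * ‖r i‖ := by rw [abs_mul, Real.norm_eq_abs, Real.norm_eq_abs]
      _ ≤ ‖v‖ * ‖r‖ := by
        gcongr
        · exact norm_le_pi_norm v i
        · exact norm_le_pi_norm r i
  have h2 : (∑ i, γ i) * ‖r‖ ≤ c * m / 2 := by
    rw [le_div_iff₀ (by positivity)] at hr
    nlinarith [norm_nonneg r]
  have h3 : ∑ i, γ i * (v i * (r i - (M.mulVec v) i)) =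
      ∑ i, γ i * (v i * r i) - ∑ i, γ i * (v i * (M.mulVec v) i) := by
    rw [← Finset.sum_sub_distrib]
    exact Finset.sum_congr rfl fun i _ => by ring
  rw [h3]
  have h4 := hq v
  have h5 : (∑ i, γ i) * (‖v‖ * ‖r‖) ≤ ‖v‖ * (c * m / 2) := by
    nlinarith [norm_nonneg v]
  have h6 : c * m * ‖v‖ ≤ c * ‖v‖ ^ 2 := by nlinarith [mul_nonneg hc.le (norm_nonneg v)]
  have h7 : c * m * m ≤ c * m * ‖v‖ := mul_le_mul_of_nonneg_left hv (by positivity)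
  nlinarith

/-- Near the origin, every velocity of the regularized Lur'e system decreases the piecewise linear
Lyapunov function with slopes `a i`, `b i` at a uniform rate while the output is nonzero. -/
theorem exists_output_dissipation {n p : ℕ} {A : Matrix (Fin n) (Fin n) ℝ}
    {B : Matrix (Fin n) (Fin p) ℝ} {C : Matrix (Fin p) (Fin n) ℝ} {ψ : Fin p → ℝ → ℝ}
    {γ a b : Fin p → ℝ} (hγ : ∀ i, 0 < γ i)
    (hM : ∀ u : Fin p → ℝ, u ≠ 0 →
      0 < u ⬝ᵥ ((Matrix.diagonal γ * (C * B) + (C * B)ᵀ * Matrix.diagonal γ).mulVec u))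
    (ha : ∀ i, 0 < a i) (hb : ∀ i, b i < 0)
    (hψa : ∀ i, Tendsto (ψ i) (nhdsWithin 0 (Ioi 0)) (nhds (a i)))
    (hψb : ∀ i, Tendsto (ψ i) (nhdsWithin 0 (Iio 0)) (nhds (b i))) :
    ∃ ρ > 0, ∃ k > 0, ∀ x f : Fin n → ℝ, ‖x‖ < ρ → f ∈ lureF A B C ψ x → C.mulVec x ≠ 0 →
      ∃ v : Fin p → ℝ, (∀ i, 0 < C.mulVec x i → v i = a i) ∧
        (∀ i, C.mulVec x i < 0 → v i = b i) ∧
        ∑ i, γ i * (v i * C.mulVec f i) ≤ -k := by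
  obtain ⟨m, hm, hmab⟩ : ∃ m > 0, ∀ i, m ≤ a i ∧ m ≤ -b i := by
    have h1 : ∀ᶠ m in nhdsWithin (0 : ℝ) (Ioi 0), ∀ i, m ≤ a i ∧ m ≤ -b i := by
      refine eventually_all.2 fun i => ?_
      have h2 : ∀ᶠ m in nhds (0 : ℝ), m ≤ a i ∧ m ≤ -b i :=
        (eventually_le_nhds (ha i)).and (eventually_le_nhds (neg_pos.2 (hb i)))
      exact h2.filter_mono nhdsWithin_le_nhds
    obtain ⟨m, h2, h3⟩ := (h1.and self_mem_nhdsWithin).exists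
    exact ⟨m, h3, h2⟩
  obtain ⟨δ, hδ, k, hk, hdiss⟩ := exists_dissipation hm hγ hM
  have hcont : Continuous fun z : (Fin n → ℝ) × (Fin p → ℝ) =>
      C.mulVec (A.mulVec z.1) - (C * B).mulVec z.2 := by
    fun_prop
  obtain ⟨ε, hε, hsmall⟩ : ∃ ε > 0, ∀ (x : Fin n → ℝ) (e : Fin p → ℝ), ‖x‖ < ε → ‖e‖ < ε →
      ‖C.mulVec (A.mulVec x) - (C * B).mulVec e‖ ≤ δ := by
    obtain ⟨ε, hε, h⟩ := Metric.continuousAt_iff.1 (hcont.continuousAt (x := 0)) δ hδ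
    refine ⟨ε, hε, fun x e hx he => ?_⟩
    have := h (x := (x, e)) (by simp [Prod.norm_def, hx, he])
    simpa using this.le
  have hnear := fun i => exists_kras_near (half_pos hε) (hψa i) (hψb i)
  choose η hη hnear using hnear
  obtain ⟨ρ, hρ, hρC⟩ : ∃ ρ > 0, ∀ x : Fin n → ℝ, ‖x‖ < ρ → ∀ i, |C.mulVec x i| < η i := by
    have h1 : ∀ᶠ x in nhds (0 : Fin n → ℝ), ∀ i, |C.mulVec x i| < η i := by
      refine eventually_all.2 fun i => ?_
      have h2 : Continuous fun x : Fin n → ℝ => |C.mulVec x i| := by fun_prop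
      exact h2.continuousAt.eventually_lt continuousAt_const (by simpa using hη i)
    obtain ⟨ρ, hρ, h⟩ := Metric.eventually_nhds_iff.1 h1
    exact ⟨ρ, hρ, fun x hx => h (by simpa using hx)⟩
  refine ⟨min ρ ε, lt_min hρ hε, k, hk, fun x f hx hf hy => ?_⟩
  obtain ⟨u, hu, rfl⟩ := hf
  set y := C.mulVec x with hydef
  let v : Fin p → ℝ := fun i => if 0 < y i then a i else if y i < 0 then b i else -u i
  have hvpos : ∀ i, 0 < y i → v i = a i := fun i h => if_pos h
  have hvneg : ∀ i, y i < 0 → v i = b i := fun i h => by simp [v, h, h.not_gt]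
  refine ⟨v, hvpos, hvneg, ?_⟩
  have he : ‖-u - v‖ < ε := by
    refine lt_of_le_of_lt ((pi_norm_le_iff_of_nonneg (half_pos hε).le).2 fun i => ?_)
      (half_lt_self hε)
    have h1 := hnear i (y i) (-u i) (hρC x (lt_of_lt_of_le hx (min_le_left _ _)) i) (hu i)
    rw [Real.norm_eq_abs, Pi.sub_apply, Pi.neg_apply]
    rcases lt_trichotomy (y i) 0 with h | h | h
    · rw [hvneg i h]
      exact h1.2 h
    · have : v i = -u i := by simp [v, h]
      rw [this]
      simpa using (half_pos hε).le
    · rw [hvpos i h]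
      exact h1.1 h
  have hv : m ≤ ‖v‖ := by
    obtain ⟨i, hi⟩ := Function.ne_iff.1 hy
    refine le_trans ?_ (norm_le_pi_norm v i)
    rcases lt_or_gt_of_ne hi with h | h
    · rw [hvneg i h, Real.norm_eq_abs, abs_of_neg (hb i)]
      exact (hmab i).2
    · rw [hvpos i h, Real.norm_eq_abs, abs_of_pos (ha i)]
      exact (hmab i).1
  have h1 := hdiss v _ hv (hsmall x (-u - v) (lt_of_lt_of_le hx (min_le_right _ _)) he)
  convert h1 using 5 with i
  have h2 : C.mulVec (A.mulVec x + B.mulVec u) =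
      C.mulVec (A.mulVec x) - (C * B).mulVec (-u - v) - (C * B).mulVec v := by
    rw [Matrix.mulVec_add, Matrix.mulVec_mulVec (v := u), Matrix.mulVec_sub, Matrix.mulVec_neg]
    abel
  rw [h2]
  rfl

theorem norm_le_euclNorm {m : ℕ} (x : Fin m → ℝ) : ‖x‖ ≤ euclNorm x := by
  refine (pi_norm_le_iff_of_nonneg (Real.sqrt_nonneg _)).2 fun i => ?_
  rw [Real.norm_eq_abs]
  exact Real.abs_le_sqrt
    (Finset.single_le_sum (f := fun j => x j ^ 2) (fun j _ => sq_nonneg _) (Finset.mem_univ i))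

theorem exists_euclNorm_mulVec_le {n p : ℕ} (C : Matrix (Fin p) (Fin n) ℝ) :
    ∃ c > 0, ∀ x : Fin n → ℝ, euclNorm (C.mulVec x) ≤ c * euclNorm x := by
  have hnorm : ∀ {m : ℕ} (x : Fin m → ℝ), euclNorm x = ‖WithLp.toLp 2 x‖ := fun x => by
    simp [EuclideanSpace.norm_eq, euclNorm]
  obtain ⟨c, hc, h⟩ := ((Matrix.toLpLin 2 2 C).toContinuousLinearMap).bound
  refine ⟨c, hc, fun x => ?_⟩
  rw [hnorm, hnorm]
  exact h (WithLp.toLp 2 x)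

theorem ClassKL.const_mul {β : ℝ → ℝ → ℝ} (hβ : ClassKL β) {c : ℝ} (hc : 0 < c) :
    ClassKL fun s t => c * β s t := by
  refine ⟨fun t ht => ?_, fun s hs => ?_⟩
  · obtain ⟨h1, h2, h3⟩ := hβ.1 t ht
    exact ⟨continuousOn_const.mul h1,
      fun x hx y hy hxy => mul_lt_mul_of_pos_left (h2 hx hy hxy) hc, by simp [h3]⟩
  · obtain ⟨h1, h2⟩ := hβ.2 s hs
    exact ⟨fun x hx y hy hxy => mul_le_mul_of_nonneg_left (h1 hx hy hxy) hc.le,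
      by simpa using h2.const_mul c⟩

/-- A solution that converges to the origin has an output that vanishes after a finite time. -/
theorem exists_output_eq_zero {n p : ℕ} {A : Matrix (Fin n) (Fin n) ℝ}
    {B : Matrix (Fin n) (Fin p) ℝ} {C : Matrix (Fin p) (Fin n) ℝ} {ψ : Fin p → ℝ → ℝ}
    {γ a b : Fin p → ℝ} (hγ : ∀ i, 0 < γ i)
    (hM : ∀ u : Fin p → ℝ, u ≠ 0 →
      0 < u ⬝ᵥ ((Matrix.diagonal γ * (C * B) + (C * B)ᵀ * Matrix.diagonal γ).mulVec u))
    (ha : ∀ i, 0 < a i) (hb : ∀ i, b i < 0)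
    (hψa : ∀ i, Tendsto (ψ i) (nhdsWithin 0 (Ioi 0)) (nhds (a i)))
    (hψb : ∀ i, Tendsto (ψ i) (nhdsWithin 0 (Iio 0)) (nhds (b i)))
    {x : ℝ → Fin n → ℝ} (hx : IsKrasovskiiSolutionOn (lureF A B C ψ) x (Ici 0))
    (hx0 : Tendsto x atTop (nhds 0)) :
    ∃ T : ℝ, 0 ≤ T ∧ ∀ t : ℝ, T ≤ t → C.mulVec (x t) = 0 := by
  obtain ⟨ρ, hρ, k, hk, hdiss⟩ := exists_output_dissipation (A := A) hγ hM ha hb hψa hψb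
  obtain ⟨f, hfint, hfF, hxf⟩ := hx
  let L : Fin p → (Fin n → ℝ) →L[ℝ] ℝ := fun i =>
    ((LinearMap.proj i).comp C.mulVecLin).toContinuousLinearMap
  have hL : ∀ i z, L i z = C.mulVec z i := fun i z => rfl
  have hgint : ∀ i t, 0 ≤ t → IntervalIntegrable (fun τ => L i (f τ)) volume 0 t :=
    fun i t ht => ⟨(L i).integrable_comp (hfint t ht).1, (L i).integrable_comp (hfint t ht).2⟩
  let y : Fin p → ℝ → ℝ := fun i t => L i (x 0) + ∫ τ in (0 : ℝ)..t, L i (f τ)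
  have hy : ∀ i t, 0 ≤ t → y i t = C.mulVec (x t) i := fun i t ht => by
    rw [← hL, hxf t ht, map_add, ← (L i).intervalIntegral_comp_comm (hfint t ht)]
  let V : Fin p → ℝ → ℝ := fun i t => γ i * max (a i * y i t) (b i * y i t)
  have hVnonneg : ∀ i t, 0 ≤ V i t := fun i t => by
    refine mul_nonneg (hγ i).le ?_
    rcases le_total 0 (y i t) with h | h
    · exact le_max_of_le_left (mul_nonneg (ha i).le h)
    · exact le_max_of_le_right (mul_nonneg_of_nonpos_of_nonpos (hb i).le h)
  have hVzero : ∀ i t, V i t = 0 ↔ y i t = 0 := fun i t => by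
    refine ⟨fun h => ?_, fun h => by simp [V, h]⟩
    have h1 : max (a i * y i t) (b i * y i t) = 0 := (mul_eq_zero.1 h).resolve_left (hγ i).ne'
    have h2 := le_max_left (a i * y i t) (b i * y i t)
    have h3 := le_max_right (a i * y i t) (b i * y i t)
    rw [h1] at h2 h3
    exact le_antisymm (by nlinarith [ha i]) (by nlinarith [hb i])
  have hyAC : ∀ i s t, 0 ≤ s → s ≤ t → AbsolutelyContinuousOnInterval (y i) s t := by
    intro i s t hs hst
    have h1 := ((hgint i t (hs.trans hst)).absolutelyContinuousOnInterval_intervalIntegral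
      (c := 0) (by simp)).mono (c := s) (d := t) (by
        rw [uIcc_of_le hst, uIcc_of_le (hs.trans hst)]
        exact Icc_subset_Icc_left hs)
    exact absolutelyContinuousOnInterval_lipschitz_comp
      (φ := fun r => L i (x 0) + r) ((isometry_add_left (L i (x 0))).lipschitz) h1
  have hmaxAC : ∀ i s t, 0 ≤ s → s ≤ t →
      AbsolutelyContinuousOnInterval (fun τ => max (a i * y i τ) (b i * y i τ)) s t := by
    intro i s t hs hst
    exact absolutelyContinuousOnInterval_lipschitz_comp (φ := fun r => max (a i * r) (b i * r))
      ((lipschitzWith_smul (a i)).max (lipschitzWith_smul (b i))) (hyAC i s t hs hst)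
  have hVAC : ∀ i s t, 0 ≤ s → s ≤ t → AbsolutelyContinuousOnInterval (V i) s t :=
    fun i s t hs hst => (hmaxAC i s t hs hst).const_mul (γ i)
  obtain ⟨T₀, hT₀⟩ := eventually_atTop.1
    (hx0.eventually (Metric.ball_mem_nhds (0 : Fin n → ℝ) hρ))
  have hderiv : ∀ s t, 0 ≤ s → s ≤ t → ∀ᵐ τ ∂volume, τ ∈ Icc s t → ∀ v : Fin p → ℝ,
      (∀ i, 0 < C.mulVec (x τ) i → v i = a i) → (∀ i, C.mulVec (x τ) i < 0 → v i = b i) →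
      ∑ i, deriv (V i) τ = ∑ i, γ i * (v i * C.mulVec (f τ) i) := by
    intro s t hs hst
    have h1 := ae_all_iff.2 fun i => (hmaxAC i s t hs hst).ae_differentiableAt
    have h2 := ae_all_iff.2 fun i => (hgint i t (hs.trans hst)).ae_hasDerivAt_integral
    filter_upwards [h1, h2] with τ h1 h2 hτ v hva hvb
    have hτ0 : 0 ≤ τ := hs.trans hτ.1
    refine Finset.sum_congr rfl fun i _ => ?_
    have h3 := (h1 i (by rwa [uIcc_of_le hst])).hasDerivAt
    have h4 : HasDerivAt (y i) (C.mulVec (f τ) i) τ :=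
      (h2 i (by rw [uIcc_of_le (hs.trans hst)]; exact ⟨hτ0, hτ.2⟩) 0 (by simp)).const_add _
    rw [(h3.const_mul (γ i)).deriv,
      hasDerivAt_max_mul_eq (v := v i) (ha i) (hb i) h4 h3 (fun h => hva i (hy i τ hτ0 ▸ h))
        fun h => hvb i (hy i τ hτ0 ▸ h)]
  set T := max T₀ 0 with hT
  have hT0 : 0 ≤ T := le_max_right _ _
  have hdecay : ∀ s t, T ≤ s → s ≤ t → ∀ c : ℝ, c ≤ k →
      ((∃ τ ∈ Icc s t, C.mulVec (x τ) = 0) → c ≤ 0) →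
      ∑ i, V i t ≤ ∑ i, V i s - c * (t - s) := by
    intro s t hs hst c hck hc
    refine sum_le_sub_of_ae_sum_deriv_le hst (fun i => hVAC i s t (hT0.trans hs) hst) ?_
    filter_upwards [hderiv s t (hT0.trans hs) hst, hfF] with τ h1 h2 hτ
    by_cases h0 : C.mulVec (x τ) = 0
    · rw [h1 hτ 0 (by simp [h0]) (by simp [h0])]
      simpa using hc ⟨τ, hτ, h0⟩
    · have hτT : T ≤ τ := hs.trans hτ.1
      obtain ⟨v, hva, hvb, hv⟩ := hdiss (x τ) (f τ)
        (by simpa using hT₀ τ ((le_max_left _ _).trans hτT)) (h2 (hT0.trans hτT)) h0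
      rw [h1 hτ v hva hvb]
      linarith
  obtain ⟨t₁, ht₁, hzero⟩ : ∃ t ≥ T, C.mulVec (x t) = 0 := by
    by_contra! hne
    have hS : 0 ≤ ∑ i, V i T := Finset.sum_nonneg fun i _ => hVnonneg i T
    have hlen : 0 ≤ (∑ i, V i T + 1) / k := by positivity
    have h1 := hdecay T (T + (∑ i, V i T + 1) / k) le_rfl (by linarith) k le_rfl
      fun ⟨τ, hτ, h0⟩ => absurd h0 (hne τ hτ.1)
    have h2 : 0 ≤ ∑ i, V i (T + (∑ i, V i T + 1) / k) :=
      Finset.sum_nonneg fun i _ => hVnonneg i _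
    rw [add_sub_cancel_left, mul_div_cancel₀ _ hk.ne'] at h1
    linarith
  refine ⟨t₁, hT0.trans ht₁, fun t ht => ?_⟩
  have ht1 : 0 ≤ t₁ := hT0.trans ht₁
  have h1 := hdecay t₁ t ht₁ ht 0 hk.le fun _ => le_rfl
  have h2 : ∑ i, V i t₁ = 0 := Finset.sum_eq_zero fun i _ =>
    (hVzero i t₁).2 (by rw [hy i t₁ ht1, hzero]; rfl)
  have h3 : ∑ i, V i t = 0 :=
    le_antisymm (by linarith) (Finset.sum_nonneg fun i _ => hVnonneg i t)
  funext i
  rw [← hy i t (ht1.trans ht)]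
  exact (hVzero i t).1
    ((Finset.sum_eq_zero_iff_of_nonneg fun j _ => hVnonneg j t).1 h3 i (Finset.mem_univ i))

/-- under Assumptions 1 and 3, the regularized Lur'e system is
output finite-time stable (oGAS plus finite-time convergence of the output). -/
theorem stmt7 {n p : ℕ} (A : Matrix (Fin n) (Fin n) ℝ) (B : Matrix (Fin n) (Fin p) ℝ)
    (C : Matrix (Fin p) (Fin n) ℝ) (ψ : Fin p → ℝ → ℝ)
    -- Assumption 1
    (hA1 : ∀ i, PiecewiseContinuous (ψ i) ∧ ∃ z : ℝ, Sector (ψ i) z)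
    -- Assumption 3 (i): CB is Lyapunov diagonally stable
    (hLDS : ∃ γb : Fin p → ℝ, (∀ i, 0 < γb i) ∧
      ∀ u : Fin p → ℝ, u ≠ 0 →
        0 < u ⬝ᵥ ((Matrix.diagonal γb * (C * B) + (C * B)ᵀ * Matrix.diagonal γb).mulVec u))
    -- Assumption 3 (ii): the origin is GAS
    (hGAS : GASOrigin A B C ψ)
    -- Assumption 3 (iii): discontinuity at the origin with sign-definite limits
    (hdisc : ∀ i, ¬ ContinuousAt (ψ i) 0 ∧
      (∃ L : ℝ, 0 < L ∧ Tendsto (ψ i) (nhdsWithin 0 (Set.Ioi 0)) (nhds L)) ∧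
      (∃ L : ℝ, L < 0 ∧ Tendsto (ψ i) (nhdsWithin 0 (Set.Iio 0)) (nhds L))) :
    (∃ β : ℝ → ℝ → ℝ, ClassKL β ∧
      ∀ x : ℝ → Fin n → ℝ,
        IsKrasovskiiSolutionOn (lureF A B C ψ) x (Set.Ici 0) →
        ∀ t : ℝ, 0 ≤ t → euclNorm (C.mulVec (x t)) ≤ β (euclNorm (x 0)) t) ∧
    (∀ x : ℝ → Fin n → ℝ,
      IsKrasovskiiSolutionOn (lureF A B C ψ) x (Set.Ici 0) →
      ∃ T : ℝ, 0 ≤ T ∧ ∀ t : ℝ, T ≤ t → C.mulVec (x t) = 0) := by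
  obtain ⟨β, hβ, hGAS⟩ := hGAS
  have htime : timeItv ⊤ = Ici 0 := by
    ext t
    simp [timeItv]
  have hbound : ∀ x : ℝ → Fin n → ℝ, IsKrasovskiiSolutionOn (lureF A B C ψ) x (Ici 0) →
      ∀ t : ℝ, 0 ≤ t → euclNorm (x t) ≤ β (euclNorm (x 0)) t := fun x hx t ht =>
    hGAS ⊤ x (by rwa [htime]) t (by rw [htime]; exact ht)
  refine ⟨?_, fun x hx => ?_⟩
  · obtain ⟨c, hc, hC⟩ := exists_euclNorm_mulVec_le C
    exact ⟨_, hβ.const_mul hc, fun x hx t ht =>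
      (hC (x t)).trans (mul_le_mul_of_nonneg_left (hbound x hx t ht) hc.le)⟩
  · obtain ⟨γ, hγ, hM⟩ := hLDS
    choose a ha hψa using fun i => (hdisc i).2.1
    choose b hb hψb using fun i => (hdisc i).2.2
    refine exists_output_eq_zero hγ hM ha hb hψa hψb hx ?_
    refine squeeze_zero_norm' ?_ (hβ.2 (euclNorm (x 0)) (Real.sqrt_nonneg _)).2
    filter_upwards [eventually_ge_atTop 0] with t ht
    exact (norm_le_euclNorm (x t)).trans (hbound x hx t ht)
end
end
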